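/- arXiv:2301.07423 — 4 statements merged into one kernel-verified Lean document; each statement's English description precedes it below -/
import Mathlib

section
/- Let A be the integral closure of the polynomial ring K[z] in F (the ring of functions of Y_{n,s} regular outside the point at infinity P_∞). Then the set {σ ∈ Aut(F/K) : σ(A) = A} is a subgroup of Aut(F/K) of order q^3·(q^2−1)·(m/s). (This subgroup is the stabilizer of P_∞ in Aut(F/K).) -/
open MvPolynomial

/-- The defining ideal of the curve `Y_{n,s}` : it is generated by
`Z^(m/s) - (Y^(q^2) - Y)` and `Y^(q+1) - (X^q + X)` in `K[X,Y,Z]`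
(variables `X 0 = X`, `X 1 = Y`, `X 2 = Z`, and `t` stands for `m/s`). -/
noncomputable def YIdeal (K : Type) [Field K] (q t : ℕ) : Ideal (MvPolynomial (Fin 3) K) :=
  Ideal.span {X 2 ^ t - (X 1 ^ (q ^ 2) - X 1), X 1 ^ (q + 1) - (X 0 ^ q + X 0)}

/-- The coordinate ring `K[X,Y,Z]/I` of the curve `Y_{n,s}`. -/
noncomputable abbrev YRing (K : Type) [Field K] (q t : ℕ) :=
  MvPolynomial (Fin 3) K ⧸ YIdeal K q t

/-- The function field `F = Frac(K[X,Y,Z]/I)` of the curve `Y_{n,s}`. -/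
noncomputable abbrev YField (K : Type) [Field K] (q t : ℕ) :=
  FractionRing (YRing K q t)

/-- The coordinate function `z ∈ F`, image of the variable `Z`. -/
noncomputable def Yz (K : Type) [Field K] (q t : ℕ) : YField K q t :=
  algebraMap (YRing K q t) (YField K q t) (Ideal.Quotient.mk _ (X 2))

structure Crv (p a q t : ℕ) (K R : Type) [Field K] [CommRing R] [Algebra K R] (x y z : R) : Prop where
  hp : p.Prime
  ha : 0 < a
  hq : q = p ^ a
  ht : 0 < t
  cop : Nat.Coprime t p
  e1 : z ^ t = y ^ (q ^ 2) - y
  e2 : y ^ (q + 1) = x ^ q + x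
  gen : Algebra.adjoin K ({x, y, z} : Set R) = ⊤

/-- degree of the monomial `x^i y^j z^k` -/
def mdeg (q t i j k : ℕ) : ℕ := q ^ 3 * k + t * ((q + 1) * i + q * j)

lemma mdeg_inj {q t i j k i' j' k' : ℕ} (hq : 2 ≤ q) (hc : Nat.Coprime t q)
    (hi : i < q) (hj : j < q ^ 2) (hi' : i' < q) (hj' : j' < q ^ 2)
    (h : mdeg q t i j k = mdeg q t i' j' k') : i = i' ∧ j = j' ∧ k = k' := by
  unfold mdeg at h
  have h1 : t * ((q + 1) * i + q * j) ≡ t * ((q + 1) * i' + q * j') [MOD q ^ 3] := by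
    have : (q ^ 3 * k + t * ((q + 1) * i + q * j)) % q ^ 3
      = (q ^ 3 * k' + t * ((q + 1) * i' + q * j')) % q ^ 3 := by rw [h]
    simpa [Nat.ModEq, Nat.mul_add_mod] using this
  have h2 : ((q + 1) * i + q * j) ≡ ((q + 1) * i' + q * j') [MOD q ^ 3] := by
    refine Nat.ModEq.cancel_left_of_coprime ?_ h1
    exact Nat.Coprime.pow_left 3 hc.symm
  have h3 : i ≡ i' [MOD q] := by
    have := h2.of_dvd (dvd_pow_self q (by norm_num : 3 ≠ 0))
    have e : ∀ u v : ℕ, (q + 1) * u + q * v = q * (u + v) + u := by intros; ring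
    rw [e, e] at this
    simpa [Nat.ModEq, Nat.mul_add_mod] using this
  have h4 : i = i' := Nat.ModEq.eq_of_lt_of_lt h3 hi hi'
  subst h4
  have h5 : q * j ≡ q * j' [MOD q * q ^ 2] := by
    have := Nat.ModEq.add_left_cancel' _ h2
    rwa [show q * q ^ 2 = q ^ 3 by ring]
  have h6 : j ≡ j' [MOD q ^ 2] := Nat.ModEq.mul_left_cancel' (by omega) h5
  have h7 : j = j' := Nat.ModEq.eq_of_lt_of_lt h6 hj hj'
  subst h7
  refine ⟨rfl, rfl, ?_⟩
  have : q ^ 3 * k = q ^ 3 * k' := by omega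
  exact Nat.eq_of_mul_eq_mul_left (by positivity) this

section
variable {p a q t : ℕ} {K R : Type} [Field K] [CommRing R] [Algebra K R] {x y z : R}

/-- span of the basic monomials of degree `< d` -/
def Wsp (K : Type) {R : Type} [Field K] [CommRing R] [Algebra K R] (q t : ℕ) (x y z : R) (d : ℕ) :
    Submodule K R :=
  Submodule.span K {f | ∃ i j k, i < q ∧ j < q ^ 2 ∧ mdeg q t i j k < d ∧ f = x ^ i * y ^ j * z ^ k}

lemma Wsp_mono {d d' : ℕ} (h : d ≤ d') : Wsp K q t x y z d ≤ Wsp K q t x y z d' := by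
  apply Submodule.span_mono
  rintro f ⟨i, j, k, hi, hj, hd, rfl⟩
  exact ⟨i, j, k, hi, hj, by omega, rfl⟩

namespace Crv

lemma q2 (C : Crv p a q t K R x y z) : 2 ≤ q := by
  rw [C.hq]
  calc 2 ≤ p := C.hp.two_le
    _ = p ^ 1 := by simp
    _ ≤ p ^ a := Nat.pow_le_pow_right C.hp.pos C.ha

lemma copq (C : Crv p a q t K R x y z) : Nat.Coprime t q := by rw [C.hq]; exact Nat.Coprime.pow_right _ C.cop

lemma span1 (C : Crv p a q t K R x y z) (i : ℕ) (hi : i < q) : ∀ j k : ℕ, ∃ d, x ^ i * y ^ j * z ^ k ∈ Wsp K q t x y z d := by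
  intro j
  induction j using Nat.strong_induction_on with
  | _ j ih =>
    intro k
    have q2 := C.q2
    have hqq : 4 ≤ q ^ 2 := by nlinarith
    by_cases hj : j < q ^ 2
    · exact ⟨mdeg q t i j k + 1, Submodule.subset_span ⟨i, j, k, hi, hj, by omega, rfl⟩⟩
    · obtain ⟨l, rfl⟩ : ∃ l, j = l + q ^ 2 := ⟨j - q ^ 2, by omega⟩
      obtain ⟨d1, h1⟩ := ih l (by omega) (k + t)
      obtain ⟨d2, h2⟩ := ih (l + 1) (by omega) k
      refine ⟨max d1 d2, ?_⟩
      have : x ^ i * y ^ (l + q ^ 2) * z ^ k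
          = x ^ i * y ^ l * z ^ (k + t) + x ^ i * y ^ (l + 1) * z ^ k := by
        have e : y ^ (q ^ 2) = z ^ t + y := by rw [C.e1]; ring
        rw [pow_add y, e]; ring
      rw [this]
      exact add_mem (Wsp_mono (le_max_left _ _) h1) (Wsp_mono (le_max_right _ _) h2)

lemma span2 (C : Crv p a q t K R x y z) : ∀ i j k : ℕ, ∃ d, x ^ i * y ^ j * z ^ k ∈ Wsp K q t x y z d := by
  intro i
  induction i using Nat.strong_induction_on with
  | _ i ih =>
    intro j k
    have q2 := C.q2
    by_cases hi : i < q
    · exact C.span1 i hi j k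
    · obtain ⟨l, rfl⟩ : ∃ l, i = l + q := ⟨i - q, by omega⟩
      obtain ⟨d1, h1⟩ := ih l (by omega) (j + (q + 1)) k
      obtain ⟨d2, h2⟩ := ih (l + 1) (by omega) j k
      refine ⟨max d1 d2, ?_⟩
      have : x ^ (l + q) * y ^ j * z ^ k
          = x ^ l * y ^ (j + (q + 1)) * z ^ k - x ^ (l + 1) * y ^ j * z ^ k := by
        rw [pow_add y, C.e2]; ring
      rw [this]
      exact sub_mem (Wsp_mono (le_max_left _ _) h1) (Wsp_mono (le_max_right _ _) h2)

lemma span3 (C : Crv p a q t K R x y z) (f : R) : ∃ d, f ∈ Wsp K q t x y z d := by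
  have hf : f ∈ Algebra.adjoin K ({x, y, z} : Set R) := by rw [C.gen]; trivial
  rw [← Subalgebra.mem_toSubmodule, Algebra.adjoin_eq_span] at hf
  induction hf using Submodule.span_induction with
  | mem g hg =>
    have : ∃ i j k, g = x ^ i * y ^ j * z ^ k := by
      induction hg using Submonoid.closure_induction with
      | mem g hg =>
        simp only [Set.mem_insert_iff, Set.mem_singleton_iff] at hg
        rcases hg with rfl | rfl | rfl
        · exact ⟨1, 0, 0, by simp⟩
        · exact ⟨0, 1, 0, by simp⟩
        · exact ⟨0, 0, 1, by simp⟩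
      | one => exact ⟨0, 0, 0, by simp⟩
      | mul u v _ _ hu hv =>
        obtain ⟨i, j, k, rfl⟩ := hu
        obtain ⟨i', j', k', rfl⟩ := hv
        exact ⟨i + i', j + j', k + k', by ring⟩
    obtain ⟨i, j, k, rfl⟩ := this
    exact C.span2 i j k
  | zero => exact ⟨0, zero_mem _⟩
  | add u v _ _ hu hv =>
    obtain ⟨d1, h1⟩ := hu
    obtain ⟨d2, h2⟩ := hv
    exact ⟨max d1 d2, add_mem (Wsp_mono (le_max_left _ _) h1) (Wsp_mono (le_max_right _ _) h2)⟩
  | smul c u _ hu =>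
    obtain ⟨d1, h1⟩ := hu
    exact ⟨d1, Submodule.smul_mem _ _ h1⟩

lemma lead_aux (C : Crv p a q t K R x y z) : ∀ (d : ℕ) (f : R), f ∈ Wsp K q t x y z d → f ≠ 0 →
    ∃ i j k, i < q ∧ j < q ^ 2 ∧ ∃ c : K, c ≠ 0 ∧
      f - c • (x ^ i * y ^ j * z ^ k) ∈ Wsp K q t x y z (mdeg q t i j k) := by
  intro d
  induction d with
  | zero =>
    intro f hf h0
    exfalso; apply h0
    simpa [Wsp] using hf
  | succ d ih =>
    intro f hf h0
    by_cases hd : ∃ i j k, i < q ∧ j < q ^ 2 ∧ mdeg q t i j k = d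
    · obtain ⟨i, j, k, hi, hj, hd⟩ := hd
      have hle : Wsp K q t x y z (d + 1) ≤ Wsp K q t x y z d ⊔ Submodule.span K {x ^ i * y ^ j * z ^ k} := by
        apply Submodule.span_le.2
        rintro f ⟨i', j', k', hi', hj', hd', rfl⟩
        by_cases hh : mdeg q t i' j' k' < d
        · exact Submodule.mem_sup_left (Submodule.subset_span ⟨i', j', k', hi', hj', hh, rfl⟩)
        · obtain ⟨rfl, rfl, rfl⟩ := mdeg_inj C.q2 C.copq hi' hj' hi hj
            (show mdeg q t i' j' k' = mdeg q t i j k by omega)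
          exact Submodule.mem_sup_right (Submodule.subset_span rfl)
      obtain ⟨w, hw, u, hu, rfl⟩ := Submodule.mem_sup.1 (hle hf)
      obtain ⟨c, rfl⟩ := Submodule.mem_span_singleton.1 hu
      by_cases hc : c = 0
      · subst hc
        simp only [zero_smul, add_zero] at h0 ⊢
        exact ih w hw h0
      · exact ⟨i, j, k, hi, hj, c, hc, by rw [hd]; simpa using hw⟩
    · push Not at hd
      apply ih f _ h0
      refine Submodule.span_mono ?_ hf
      rintro f ⟨i', j', k', hi', hj', hd', rfl⟩
      have := hd i' j' k' hi' hj'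
      exact ⟨i', j', k', hi', hj', by omega, rfl⟩

lemma lead (C : Crv p a q t K R x y z) (f : R) (h0 : f ≠ 0) :
    ∃ i j k, i < q ∧ j < q ^ 2 ∧ ∃ c : K, c ≠ 0 ∧
      f - c • (x ^ i * y ^ j * z ^ k) ∈ Wsp K q t x y z (mdeg q t i j k) := by
  obtain ⟨d, hd⟩ := C.span3 f
  exact C.lead_aux d f hd h0

end Crv
end

section
open Polynomial
variable {p a q t : ℕ} {K R : Type} [Field K] [CommRing R] [Algebra K R] {x y z : R}
variable {G : Type} [LinearOrderedCommGroupWithZero G] {v : Valuation R G}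

structure Gd (K : Type) {R : Type} [Field K] [CommRing R] [Algebra K R] (z : R)
    {G : Type} [LinearOrderedCommGroupWithZero G] (v : Valuation R G) : Prop where
  hK : ∀ c : K, c ≠ 0 → v (algebraMap K R c) = 1
  hz : 1 < v z

/-- `f` has degree `d` -/
def Dg (K : Type) {R : Type} [Field K] [CommRing R] [Algebra K R] (q t : ℕ) (x y z : R)
    (f : R) (d : ℕ) : Prop :=
  ∃ i j k, i < q ∧ j < q ^ 2 ∧ mdeg q t i j k = d ∧ ∃ c : K, c ≠ 0 ∧
      f - c • (x ^ i * y ^ j * z ^ k) ∈ Wsp K q t x y z d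

namespace Crv

lemma exDg (C : Crv p a q t K R x y z) (f : R) (hf : f ≠ 0) : ∃ d, Dg K q t x y z f d := by
  obtain ⟨i, j, k, hi, hj, c, hc, h⟩ := C.lead f hf
  exact ⟨_, i, j, k, hi, hj, rfl, c, hc, h⟩

lemma vy (C : Crv p a q t K R x y z) (g : Gd K z v) : v y ^ (q ^ 2) = v z ^ t := by
  have q2 := C.q2
  have h1 : 1 < v z ^ t := one_lt_pow₀ g.hz C.ht.ne'
  have hy1 : 1 < v y := by
    by_contra h
    push Not at h
    have : v (z ^ t) ≤ 1 := by
      rw [C.e1]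
      refine (v.map_sub _ _).trans (max_le ?_ h)
      rw [map_pow]; exact pow_le_one' h _
    rw [map_pow] at this
    exact absurd h1 (not_lt.2 this)
  have hlt : v y < v (y ^ (q ^ 2)) := by
    rw [map_pow]
    calc v y = v y ^ 1 := by simp
      _ < _ := pow_lt_pow_right₀ hy1 (by nlinarith)
  rw [← map_pow, ← map_pow, C.e1, Valuation.map_sub_eq_of_lt_left _ hlt]

lemma vx (C : Crv p a q t K R x y z) (g : Gd K z v) : v x ^ q = v y ^ (q + 1) := by
  have q2 := C.q2
  have h1 : 1 < v y := by
    have := C.vy g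
    have h1 : 1 < v z ^ t := one_lt_pow₀ g.hz C.ht.ne'
    by_contra h
    push Not at h
    have h2 : v y ^ (q ^ 2) ≤ 1 := pow_le_one' h _
    rw [this] at h2
    exact absurd h1 (not_lt.2 h2)
  have h1' : 1 < v y ^ (q + 1) := one_lt_pow₀ h1 (by omega)
  have hx1 : 1 < v x := by
    by_contra h
    push Not at h
    have : v (y ^ (q + 1)) ≤ 1 := by
      rw [C.e2]
      refine (v.map_add _ _).trans (max_le ?_ h)
      rw [map_pow]; exact pow_le_one' h _
    rw [map_pow] at this
    exact absurd h1' (not_lt.2 this)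
  have hlt : v x < v (x ^ q) := by
    rw [map_pow]
    calc v x = v x ^ 1 := by simp
      _ < _ := pow_lt_pow_right₀ hx1 (by omega)
  rw [← map_pow, ← map_pow, C.e2, Valuation.map_add_eq_of_lt_left _ hlt]

lemma vmono (C : Crv p a q t K R x y z) (g : Gd K z v) (i j k : ℕ) :
    v (x ^ i * y ^ j * z ^ k) ^ (q ^ 3) = v z ^ (mdeg q t i j k) := by
  have h1 := C.vx g
  have h2 := C.vy g
  calc v (x ^ i * y ^ j * z ^ k) ^ (q ^ 3)
      = (v x ^ q) ^ (q ^ 2 * i) * (v y ^ (q ^ 2)) ^ (q * j) * v z ^ (q ^ 3 * k) := by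
        simp only [map_mul, map_pow, mul_pow, ← pow_mul]; ring_nf
    _ = (v y ^ (q ^ 2)) ^ ((q + 1) * i + q * j) * v z ^ (q ^ 3 * k) := by
        rw [h1]; simp only [← pow_mul, ← pow_add]; ring_nf
    _ = v z ^ (mdeg q t i j k) := by
        rw [h2]; simp only [← pow_mul, ← pow_add, mdeg]; ring_nf

lemma vW (C : Crv p a q t K R x y z) (g : Gd K z v) {d : ℕ} {f : R} (hf : f ∈ Wsp K q t x y z d) :
    v f ^ (q ^ 3) < v z ^ d := by
  have hz0 : 0 < v z := lt_trans zero_lt_one g.hz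
  have q2 := C.q2
  have q3 : q ^ 3 ≠ 0 := by positivity
  induction hf using Submodule.span_induction with
  | mem f hf =>
    obtain ⟨i, j, k, hi, hj, hd, rfl⟩ := hf
    rw [C.vmono g]
    exact pow_lt_pow_right₀ g.hz hd
  | zero => rw [map_zero, zero_pow q3]; exact pow_pos hz0 _
  | add a b _ _ ha hb =>
    rcases le_total (v a) (v b) with h | h
    · have : v (a + b) ≤ v b := (v.map_add a b).trans (max_le h le_rfl)
      exact lt_of_le_of_lt (pow_le_pow_left' this _) hb
    · have : v (a + b) ≤ v a := (v.map_add a b).trans (max_le le_rfl h)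
      exact lt_of_le_of_lt (pow_le_pow_left' this _) ha
  | smul c f _ hf =>
    by_cases hc : c = 0
    · subst hc; rw [zero_smul, map_zero, zero_pow q3]; exact pow_pos hz0 _
    · rw [Algebra.smul_def, map_mul, g.hK c hc, one_mul]; exact hf

lemma vDg (C : Crv p a q t K R x y z) (g : Gd K z v) {d : ℕ} {f : R} (hf : Dg K q t x y z f d) :
    v f ^ (q ^ 3) = v z ^ d := by
  obtain ⟨i, j, k, hi, hj, rfl, c, hc, h⟩ := hf
  have e : v (c • (x ^ i * y ^ j * z ^ k)) = v (x ^ i * y ^ j * z ^ k) := by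
    rw [Algebra.smul_def, map_mul, g.hK c hc, one_mul]
  have h1 := C.vW g h
  rw [← C.vmono g i j k, ← e] at h1
  have h2 := lt_of_pow_lt_pow_left' _ h1
  have h3 := Valuation.map_add_eq_of_lt_left v h2
  rw [add_sub_cancel] at h3
  rw [h3, e, C.vmono g]

lemma DgZ (C : Crv p a q t K R x y z) : Dg K q t x y z z (q ^ 3) := by
  have := C.q2
  exact ⟨0, 0, 1, by omega, by positivity, by simp [mdeg], 1, one_ne_zero, by simp⟩

lemma DgY (C : Crv p a q t K R x y z) : Dg K q t x y z y (t * q) := by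
  have := C.q2
  exact ⟨0, 1, 0, by omega, by nlinarith, by simp [mdeg], 1, one_ne_zero, by simp⟩

lemma DgX (C : Crv p a q t K R x y z) : Dg K q t x y z x (t * (q + 1)) := by
  have := C.q2
  exact ⟨1, 0, 0, by omega, by positivity, by simp [mdeg], 1, one_ne_zero, by simp⟩

lemma vpinj_aux (g : Gd K z v) {d d' : ℕ} (h : v z ^ d = v z ^ d') : d = d' :=
  (pow_right_strictMono₀ g.hz).injective h

lemma Dg_pos (C : Crv p a q t K R x y z) (g : Gd K z v) {d : ℕ} (σ : R ≃ₐ[K] R) (hd : Dg K q t x y z (σ z) d) : 0 < d := by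
  rcases Nat.eq_zero_or_pos d with rfl | h
  swap; · exact h
  exfalso
  obtain ⟨i, j, k, hi, hj, h0, c, hc, h⟩ := hd
  have q2 := C.q2
  have ht := C.ht
  have hi0 : i = 0 ∧ j = 0 ∧ k = 0 := by
    have : i = 0 ∧ j = 0 ∧ k = 0 := mdeg_inj (k' := 0) C.q2 C.copq hi hj (i' := 0) (j' := 0)
      (by omega) (by positivity) (by rw [h0]; simp [mdeg])
    exact this
  obtain ⟨rfl, rfl, rfl⟩ := hi0
  have h1 : σ z - c • 1 = 0 := by simpa [Wsp] using h
  have h2 : σ z = σ (algebraMap K R c) := by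
    rw [AlgEquiv.commutes, Algebra.algebraMap_eq_smul_one]; exact sub_eq_zero.1 h1
  have h3 := σ.injective h2
  have := g.hz
  rw [h3, g.hK c hc] at this
  exact lt_irrefl _ this

lemma gd_comap (C : Crv p a q t K R x y z) (g : Gd K z v) (σ : R ≃ₐ[K] R) : Gd K z (v.comap (σ : R →+* R)) := by
  refine ⟨fun c hc => ?_, ?_⟩
  · simpa using g.hK c hc
  · have hz0 : z ≠ 0 := by
      rintro h
      have := g.hz
      rw [h, map_zero] at this
      exact absurd this (not_lt.2 zero_le_one)
    obtain ⟨d, hd⟩ := C.exDg (σ z) (by simpa using hz0)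
    have h1 := C.vDg g hd
    have h2 := C.Dg_pos g σ hd
    have h3 : 1 < v (σ z) ^ (q ^ 3) := by rw [h1]; exact one_lt_pow₀ g.hz h2.ne'
    change 1 < v (σ z)
    by_contra h
    push Not at h
    exact absurd h3 (not_lt.2 (pow_le_one' h _))

lemma dscale (C : Crv p a q t K R x y z) (g : Gd K z v) (σ : R ≃ₐ[K] R) {f : R} {d d' e : ℕ} (h : Dg K q t x y z f d)
    (h' : Dg K q t x y z (σ f) d') (he : Dg K q t x y z (σ z) e) : d' * q ^ 3 = e * d := by
  have h1 : v (σ f) ^ (q ^ 3) = v (σ z) ^ d := C.vDg (C.gd_comap g σ) h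
  have h2 := C.vDg g h'
  have h3 := C.vDg g he
  apply vpinj_aux g
  rw [pow_mul, ← h2, h1, pow_mul, ← h3, ← pow_mul, ← pow_mul, mul_comm]

lemma dge (C : Crv p a q t K R x y z) (g : Gd K z v) (σ : R ≃ₐ[K] R) {e : ℕ} (he : Dg K q t x y z (σ z) e) : q ^ 3 ≤ e := by
  classical
  have q2 := C.q2
  have ex : ∃ d, 0 < d ∧ ∃ f, f ≠ 0 ∧ Dg K q t x y z f d := ⟨q ^ 3, by positivity, z, by
    rintro h
    have := g.hz
    rw [h, map_zero] at this
    exact absurd this (not_lt.2 zero_le_one), C.DgZ⟩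
  obtain ⟨hpos, f, hf0, hf⟩ := Nat.find_spec ex
  set d0 := Nat.find ex with hd0
  obtain ⟨d1, h1⟩ := C.exDg (σ f) (by simpa using hf0)
  have h2 := C.dscale g σ hf h1 he
  have he0 := C.Dg_pos g σ he
  have hd1 : 0 < d1 := by
    rcases Nat.eq_zero_or_pos d1 with rfl | h
    · have : 0 < e * d0 := by positivity
      omega
    · exact h
  have hle : d0 ≤ d1 := Nat.find_min' ex ⟨hd1, σ f, by simpa using hf0, h1⟩
  have h3 : d0 * q ^ 3 ≤ e * d0 := by rw [← h2]; gcongr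
  rw [mul_comm] at h3
  exact Nat.le_of_mul_le_mul_right h3 hpos

lemma dinv (C : Crv p a q t K R x y z) (g : Gd K z v) (σ : R ≃ₐ[K] R) {f : R} {d : ℕ} (hf0 : f ≠ 0)
    (h : Dg K q t x y z f d) : Dg K q t x y z (σ f) d := by
  have q2 := C.q2
  have hz0 : z ≠ 0 := by
    rintro h
    have := g.hz
    rw [h, map_zero] at this
    exact absurd this (not_lt.2 zero_le_one)
  obtain ⟨d', h'⟩ := C.exDg (σ f) (by simpa using hf0)
  obtain ⟨e, he⟩ := C.exDg (σ z) (by simpa using hz0)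
  obtain ⟨e', he'⟩ := C.exDg (σ.symm z) (by simpa using hz0)
  have h1 := C.dge g σ he
  have h2 := C.dge g σ.symm he'
  have h3 : q ^ 3 * q ^ 3 = e * e' := C.dscale g σ (f := σ.symm z) he' (by simpa using C.DgZ) he
  have h4 := C.dscale g σ h h' he
  have hq : 0 < q ^ 3 := by positivity
  have h5 : e = q ^ 3 := by nlinarith
  rw [h5, mul_comm] at h4
  have : d' = d := Nat.eq_of_mul_eq_mul_left hq h4
  rwa [this] at h'

lemma Dg_poly (C : Crv p a q t K R x y z) {i j : ℕ} (hi : i < q) (hj : j < q ^ 2) {P : K[X]} (hP : P ≠ 0) :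
    Dg K q t x y z (Polynomial.aeval z P * (x ^ i * y ^ j)) (mdeg q t i j P.natDegree) := by
  refine ⟨i, j, P.natDegree, hi, hj, rfl, P.leadingCoeff, by simpa using hP, ?_⟩
  rw [Polynomial.aeval_eq_sum_range, Finset.sum_range_succ, add_mul]
  have : P.coeff P.natDegree • z ^ P.natDegree * (x ^ i * y ^ j)
      = P.leadingCoeff • (x ^ i * y ^ j * z ^ P.natDegree) := by
    rw [smul_mul_assoc, mul_comm (z ^ _)]; rfl
  rw [this, add_sub_cancel_right, Finset.sum_mul]
  refine sum_mem fun k hk => ?_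
  rw [smul_mul_assoc]
  refine Submodule.smul_mem _ _ (Submodule.subset_span ⟨i, j, k, hi, hj, ?_, by ring⟩)
  have := Finset.mem_range.1 hk
  have q2 := C.q2
  unfold mdeg
  have : q ^ 3 * k < q ^ 3 * P.natDegree := by gcongr
  omega

lemma indep (C : Crv p a q t K R x y z) (g : Gd K z v) (s : Finset (ℕ × ℕ)) (P : ℕ × ℕ → K[X])
    (hs : ∀ e ∈ s, e.1 < q ∧ e.2 < q ^ 2)
    (h : ∑ e ∈ s, Polynomial.aeval z (P e) * (x ^ e.1 * y ^ e.2) = 0) : ∀ e ∈ s, P e = 0 := by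
  classical
  by_contra hcon
  push Not at hcon
  obtain ⟨e0, he0, hP0⟩ := hcon
  set s' := s.filter (fun e => P e ≠ 0) with hs'
  have hsum : ∑ e ∈ s', Polynomial.aeval z (P e) * (x ^ e.1 * y ^ e.2) = 0 := by
    rw [← h]
    apply Finset.sum_subset (Finset.filter_subset _ _)
    intro e he hn
    have : P e = 0 := by
      by_contra hh; exact hn (Finset.mem_filter.2 ⟨he, hh⟩)
    rw [this]; simp
  obtain ⟨m, hm, hmax⟩ := Finset.exists_max_image s'
    (fun e => v (Polynomial.aeval z (P e) * (x ^ e.1 * y ^ e.2))) ⟨e0, Finset.mem_filter.2 ⟨he0, hP0⟩⟩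
  have key : ∀ e ∈ s', v (Polynomial.aeval z (P e) * (x ^ e.1 * y ^ e.2)) ^ (q ^ 3)
      = v z ^ mdeg q t e.1 e.2 (P e).natDegree := by
    intro e he
    obtain ⟨he1, he2⟩ := Finset.mem_filter.1 he
    exact C.vDg g (C.Dg_poly (hs e he1).1 (hs e he1).2 he2)
  have h1 := Valuation.map_sum_eq_of_lt (v := v) hm (f := fun e => Polynomial.aeval z (P e) * (x ^ e.1 * y ^ e.2)) ?_
  · rw [hsum, map_zero] at h1
    have h2 := key m hm
    have q2 := C.q2
    rw [← h1, zero_pow (by positivity)] at h2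
    exact (pow_pos (lt_trans zero_lt_one g.hz) _).ne h2
  · intro e he
    obtain ⟨he1, he2⟩ := Finset.mem_sdiff.1 he
    refine lt_of_le_of_ne (hmax e he1) ?_
    intro heq
    have h2 := key e he1
    rw [heq, key m hm] at h2
    have h3 := vpinj_aux g h2
    have hsm := hs m (Finset.mem_filter.1 hm).1
    have hse := hs e (Finset.mem_filter.1 he1).1
    obtain ⟨a1, a2, -⟩ := mdeg_inj C.q2 C.copq hsm.1 hsm.2 hse.1 hse.2 h3
    exact he2 (by simp [Prod.ext_iff, a1, a2])

end Crv
end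

section
open Polynomial

lemma alg_mem {K L : Type} [Field K] [IsAlgClosed K] [CommRing L] [IsDomain L] [Algebra K L] (f : L)
    (hf : IsAlgebraic K f) : ∃ c : K, f = algebraMap K L c := by
  obtain ⟨P, hP, h⟩ := hf
  have hs := IsAlgClosed.splits P
  have h1 := hs.eq_prod_roots
  rw [h1] at h
  simp only [map_mul, Polynomial.aeval_C, mul_eq_zero] at h
  rcases h with h | h
  · exfalso
    have := (FaithfulSMul.algebraMap_injective K L) (h.trans (map_zero _).symm)
    exact hP (by simpa using this)
  · rw [map_multiset_prod, Multiset.prod_eq_zero_iff] at h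
    simp only [Multiset.map_map, Multiset.mem_map, Function.comp] at h
    obtain ⟨c, -, hc⟩ := h
    refine ⟨c, ?_⟩
    simp only [map_sub, Polynomial.aeval_X, Polynomial.aeval_C] at hc
    exact sub_eq_zero.1 hc

variable {p a q t : ℕ} {K R : Type} [Field K] [CommRing R] [Algebra K R] {x y z : R}
variable {G : Type} [LinearOrderedCommGroupWithZero G] {v : Valuation R G}

namespace Crv

lemma Wy {w : R} (hw : w ∈ Wsp K q t x y z (t * q)) : ∃ B : K[X], w = Polynomial.aeval z B := by
  induction hw using Submodule.span_induction with
  | mem f hf =>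
    obtain ⟨i, j, k, hi, hj, hd, rfl⟩ := hf
    have h1 : t * ((q + 1) * i + q * j) < t * q := by unfold mdeg at hd; omega
    have h2 := lt_of_mul_lt_mul_left h1 (by omega)
    have hi0 : i = 0 := by
      rcases Nat.eq_zero_or_pos i with h | h
      · exact h
      · nlinarith
    have hj0 : j = 0 := by
      rcases Nat.eq_zero_or_pos j with h | h
      · exact h
      · nlinarith
    subst hi0 hj0
    exact ⟨Polynomial.X ^ k, by simp⟩
  | zero => exact ⟨0, by simp⟩
  | add a b _ _ ha hb =>
    obtain ⟨A, rfl⟩ := ha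
    obtain ⟨B, rfl⟩ := hb
    exact ⟨A + B, by simp⟩
  | smul c f _ hf =>
    obtain ⟨A, rfl⟩ := hf
    exact ⟨c • A, by simp⟩

lemma Wx (C : Crv p a q t K R x y z) {w : R} (hw : w ∈ Wsp K q t x y z (t * (q + 1))) :
    ∃ B D : K[X], w = Polynomial.aeval z B * y + Polynomial.aeval z D := by
  have q2 := C.q2
  induction hw using Submodule.span_induction with
  | mem f hf =>
    obtain ⟨i, j, k, hi, hj, hd, rfl⟩ := hf
    have h1 : t * ((q + 1) * i + q * j) < t * (q + 1) := by unfold mdeg at hd; omega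
    have h2 := lt_of_mul_lt_mul_left h1 (by omega)
    have hi0 : i = 0 := by
      rcases Nat.eq_zero_or_pos i with h | h
      · exact h
      · nlinarith
    have hj0 : j = 0 ∨ j = 1 := by
      rcases Nat.lt_or_ge j 2 with h | h
      · omega
      · nlinarith
    subst hi0
    rcases hj0 with rfl | rfl
    · exact ⟨0, Polynomial.X ^ k, by simp⟩
    · exact ⟨Polynomial.X ^ k, 0, by simp [mul_comm]⟩
  | zero => exact ⟨0, 0, by simp⟩
  | add a b _ _ ha hb =>
    obtain ⟨A, A', rfl⟩ := ha
    obtain ⟨B, B', rfl⟩ := hb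
    exact ⟨A + B, A' + B', by simp; ring⟩
  | smul c f _ hf =>
    obtain ⟨A, A', rfl⟩ := hf
    exact ⟨c • A, c • A', by simp [smul_add]⟩

lemma classify (C : Crv p a q t K R x y z) [IsAlgClosed K] [IsDomain R] [CharP K p] (g : Gd K z v) (σ : R ≃ₐ[K] R) :
    ∃ c b γ : K, c ^ (t * (q ^ 2 - 1)) = 1 ∧ b ^ (q ^ 2) = b ∧ γ ^ q + γ = b ^ (q + 1) ∧
      σ z = c • z ∧ σ y = c ^ t • y + algebraMap K R b ∧
      σ x = c ^ (t * (q + 1)) • x + (c ^ t * b ^ q) • y + algebraMap K R γ := by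
  have q2 := C.q2
  have hqq : q + 1 < q ^ 2 := by nlinarith
  have : Fact p.Prime := ⟨C.hp⟩
  have : CharP R p := charP_of_injective_algebraMap (FaithfulSMul.algebraMap_injective K R) p
  have hz0 : z ≠ 0 := by
    rintro h
    have := g.hz
    rw [h, map_zero] at this
    exact absurd this (not_lt.2 zero_le_one)
  have hy0 : y ≠ 0 := by
    rintro h
    have := C.e1
    rw [h, zero_pow (by positivity), sub_zero] at this
    exact hz0 (pow_eq_zero_iff C.ht.ne' |>.1 this)
  have hx0 : x ≠ 0 := by
    rintro h
    have := C.e2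
    rw [h, zero_pow (by omega), add_zero] at this
    exact hy0 (pow_eq_zero_iff (by omega) |>.1 this)
  obtain ⟨i, j, k, hi, hj, hd, a', ha0, hw⟩ := C.dinv g σ hy0 C.DgY
  obtain ⟨rfl, rfl, rfl⟩ := mdeg_inj (i' := 0) (j' := 1) (k' := 0) C.q2 C.copq hi hj (by omega) (by nlinarith)
    (hd.trans (by simp [mdeg]))
  obtain ⟨B, hB⟩ := Wy hw
  obtain ⟨i, j, k, hi, hj, hd, al, hal0, hw'⟩ := C.dinv g σ hx0 C.DgX
  obtain ⟨rfl, rfl, rfl⟩ := mdeg_inj (i' := 1) (j' := 0) (k' := 0) C.q2 C.copq hi hj (by omega) (by nlinarith)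
    (hd.trans (by simp [mdeg]))
  obtain ⟨Be, Ga, hBG⟩ := C.Wx hw'
  have hsy : σ y = algebraMap K R a' * y + Polynomial.aeval z B := by
    rw [← hB]; simp [Algebra.smul_def]
  have hsx : σ x = algebraMap K R al * x + (Polynomial.aeval z Be * y + Polynomial.aeval z Ga) := by
    rw [← hBG]; simp [Algebra.smul_def]
  have frob : ∀ u w : R, (u + w) ^ q = u ^ q + w ^ q := by
    intro u w; rw [C.hq]; exact add_pow_char_pow ..
  have hE : (σ y) ^ q * σ y = (σ x) ^ q + σ x := by
    rw [← pow_succ, ← map_pow, C.e2]; simp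
  rw [hsy, hsx] at hE
  simp only [frob, mul_pow] at hE
  set P : ℕ × ℕ → K[X] := fun e =>
    if e = (0, 0) then B ^ (q + 1) - Ga ^ q - Ga
    else if e = (1, 0) then Polynomial.C (al ^ q - al)
    else if e = (0, 1) then Polynomial.C a' * B ^ q - Be
    else if e = (0, q) then Polynomial.C (a' ^ q) * B - Be ^ q
    else Polynomial.C (a' ^ (q + 1) - al ^ q) with hP
  have P0 : P (0, 0) = B ^ (q + 1) - Ga ^ q - Ga := by simp [hP]
  have P1 : P (1, 0) = Polynomial.C (al ^ q - al) := by simp [hP]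
  have P2 : P (0, 1) = Polynomial.C a' * B ^ q - Be := by simp [hP]
  have P3 : P (0, q) = Polynomial.C (a' ^ q) * B - Be ^ q := by
    simp only [hP]; rw [if_neg, if_neg, if_neg, if_pos trivial] <;> simp <;> omega
  have P4 : P (0, q + 1) = Polynomial.C (a' ^ (q + 1) - al ^ q) := by
    simp only [hP]; rw [if_neg, if_neg, if_neg, if_neg] <;> simp <;> omega
  have hind := C.indep g {(0, 0), (1, 0), (0, 1), (0, q), (0, q + 1)} P ?_ ?_
  rotate_left
  · intro e he
    simp only [Finset.mem_insert, Finset.mem_singleton] at he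
    rcases he with rfl | rfl | rfl | rfl | rfl <;> constructor <;> simp <;> omega
  · rw [Finset.sum_insert, Finset.sum_insert, Finset.sum_insert, Finset.sum_insert,
      Finset.sum_singleton, P0, P1, P2, P3, P4]
    · simp only [map_sub, map_mul, map_pow, Polynomial.aeval_C, pow_zero, pow_one, mul_one, one_mul]
      linear_combination hE - (algebraMap K R al) ^ q * C.e2
    all_goals simp
    all_goals omega
  have h0 := hind (0, 0) (by simp)
  have h1 := hind (1, 0) (by simp)
  have h2 := hind (0, 1) (by simp)
  have h3 := hind (0, q) (by simp)
  have h4 := hind (0, q + 1) (by simp)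
  rw [P0] at h0
  rw [P1, Polynomial.C_eq_zero, sub_eq_zero] at h1
  rw [P2, sub_eq_zero] at h2
  rw [P3, sub_eq_zero] at h3
  rw [P4, Polynomial.C_eq_zero, sub_eq_zero] at h4
  have h5 : B = B ^ (q ^ 2) := by
    rw [← h2, mul_pow, ← pow_mul, ← map_pow, ← sq] at h3
    exact mul_left_cancel₀ (by simpa using pow_ne_zero q ha0) h3
  have hBd : B.natDegree = 0 := by
    have := congrArg natDegree h5
    rw [Polynomial.natDegree_pow] at this
    have h6 : 1 < q ^ 2 := by omega
    rcases Nat.eq_zero_or_pos B.natDegree with h | h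
    · exact h
    · nlinarith
  obtain ⟨b, rfl⟩ : ∃ b, B = Polynomial.C b := ⟨_, eq_C_of_natDegree_eq_zero hBd⟩
  have hb : b ^ (q ^ 2) = b := by
    rw [← map_pow] at h5; exact (Polynomial.C_injective h5).symm
  have hGd : Ga.natDegree = 0 := by
    by_contra hne
    have h6 : Ga ^ q + Ga = Polynomial.C (b ^ (q + 1)) := by
      rw [map_pow]; linear_combination -h0
    have h7 : Ga.natDegree < (Ga ^ q).natDegree := by
      rw [Polynomial.natDegree_pow]
      have : 0 < Ga.natDegree := by omega
      nlinarith
    have h8 := Polynomial.natDegree_add_eq_left_of_natDegree_lt h7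
    rw [h6, Polynomial.natDegree_C] at h8
    omega
  obtain ⟨γ, rfl⟩ : ∃ b, Ga = Polynomial.C b := ⟨_, eq_C_of_natDegree_eq_zero hGd⟩
  have hγ : γ ^ q + γ = b ^ (q + 1) := by
    have h6 : Polynomial.C (γ ^ q + γ) = Polynomial.C (b ^ (q + 1)) := by
      rw [map_pow, map_add, map_pow]; linear_combination -h0
    exact Polynomial.C_injective h6
  have hal : al = a' ^ (q + 1) := by rw [h4, h1]
  have ha1 : a' ^ (q ^ 2 - 1) = 1 := by
    rw [hal, ← pow_mul] at h1
    have e : (q + 1) * q = (q + 1) + (q ^ 2 - 1) := by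
      have : 1 ≤ q ^ 2 := by omega
      zify [this]; ring
    rw [e, pow_add] at h1
    exact mul_left_cancel₀ (pow_ne_zero (q + 1) ha0) (by rw [h1, mul_one])
  have ha2 : a' ^ (q ^ 2) = a' := by
    have : q ^ 2 = (q ^ 2 - 1) + 1 := by omega
    rw [this, pow_succ, ha1, one_mul]
  have frob2 : ∀ u w : R, (u + w) ^ (q ^ 2) = u ^ (q ^ 2) + w ^ (q ^ 2) := by
    intro u w; rw [sq, pow_mul, frob, frob, ← pow_mul, ← pow_mul]
  have hzt : (σ z) ^ t = algebraMap K R a' * z ^ t := by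
    rw [← map_pow, C.e1, map_sub, map_pow, hsy, frob2, mul_pow, ← map_pow, ha2, Polynomial.aeval_C,
      ← map_pow, hb]
    ring
  obtain ⟨c, hc⟩ : ∃ c : K, σ z = algebraMap K R c * z := by
    obtain ⟨c, hc⟩ := alg_mem (K := K) (L := FractionRing R)
      (algebraMap R (FractionRing R) (σ z) / algebraMap R (FractionRing R) z) (by
        refine ⟨Polynomial.X ^ t - Polynomial.C a', X_pow_sub_C_ne_zero C.ht _, ?_⟩
        have : algebraMap R (FractionRing R) z ≠ 0 := by simpa using hz0
        simp only [map_sub, map_pow, Polynomial.aeval_X, Polynomial.aeval_C, div_pow]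
        rw [← map_pow, hzt, map_mul, map_pow, ← IsScalarTower.algebraMap_apply K R (FractionRing R)]
        field_simp
        simp)
    refine ⟨c, IsFractionRing.injective R (FractionRing R) ?_⟩
    have : algebraMap R (FractionRing R) z ≠ 0 := by simpa using hz0
    rw [map_mul, ← IsScalarTower.algebraMap_apply K R (FractionRing R), ← hc]
    field_simp
  have hct : c ^ t = a' := by
    rw [hc, mul_pow, ← map_pow] at hzt
    exact FaithfulSMul.algebraMap_injective K R (mul_right_cancel₀ (pow_ne_zero t hz0) hzt)
  refine ⟨c, b, γ, ?_, hb, hγ, ?_, ?_, ?_⟩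
  · rw [pow_mul, hct, ha1]
  · rw [hc, Algebra.smul_def]
  · rw [hsy, hct, Algebra.smul_def, Polynomial.aeval_C]
  · rw [hsx, pow_mul, hct, ← hal, ← h2, Algebra.smul_def, Algebra.smul_def]
    simp only [map_mul, map_pow, Polynomial.aeval_C]
    ring

end Crv
end

section
open Polynomial

lemma noeth_inj {S : Type} [CommRing S] [IsNoetherianRing S] (f : S →+* S)
    (hf : Function.Surjective f) : Function.Injective f := by
  have hs : ∀ n : ℕ, Function.Surjective (f ^ n : S →+* S) := by
    intro n; rw [RingHom.coe_pow]; exact hf.iterate n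
  let K : ℕ →o Ideal S := ⟨fun n => RingHom.ker (f ^ n : S →+* S), by
    apply monotone_nat_of_le_succ
    intro n u hu
    rw [RingHom.mem_ker] at hu ⊢
    rw [pow_succ', RingHom.mul_def, RingHom.comp_apply, hu, map_zero]⟩
  obtain ⟨n, hn⟩ := monotone_stabilizes_iff_noetherian.2 (inferInstance : IsNoetherian S S) K
  rw [injective_iff_map_eq_zero]
  intro u hu
  obtain ⟨w, rfl⟩ := hs n u
  have h1 : w ∈ K (n + 1) := by
    change w ∈ RingHom.ker (f ^ (n + 1) : S →+* S)
    rw [RingHom.mem_ker, pow_succ', RingHom.mul_def, RingHom.comp_apply, hu]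
  rw [← hn (n + 1) (by omega)] at h1
  exact h1

lemma card_roots_sep {K : Type} [Field K] [IsAlgClosed K] (P : K[X]) (hP : P.Separable)
    (S : K → Prop) (hS : ∀ u, S u ↔ P.eval u = 0) : Nat.card {u : K // S u} = P.natDegree := by
  have h1 := card_rootSet_eq_natDegree (K := K) hP (IsAlgClosed.splits_domain _)
  rw [← h1, ← Nat.card_eq_fintype_card]
  refine Nat.card_congr (Equiv.subtypeEquivRight fun u => ?_)
  rw [hS, mem_rootSet_of_ne hP.ne_zero]
  simp [Polynomial.aeval_def]

lemma sep_of_deriv {K : Type} [Field K] (P : K[X]) (u : K) (hu : u ≠ 0)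
    (h : derivative P = Polynomial.C u) : P.Separable := by
  rw [separable_def, h]
  exact ⟨0, Polynomial.C u⁻¹, by rw [← map_mul, inv_mul_cancel₀ hu]; simp⟩

/-- parameter set for the automorphisms -/
abbrev TT (K : Type) [Field K] (q t : ℕ) : Type :=
  {c : K // c ^ (t * (q ^ 2 - 1)) = 1} ×
    (Σ b : {b : K // b ^ (q ^ 2) = b}, {γ : K // γ ^ q + γ = b.1 ^ (q + 1)})

variable {p a q t : ℕ} {K R : Type} [Field K] [CommRing R] [Algebra K R] {x y z : R}
variable {G : Type} [LinearOrderedCommGroupWithZero G] {v : Valuation R G}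

namespace Crv

lemma castq (C : Crv p a q t K R x y z) [CharP K p] : (q : K) = 0 := by
  have := C.ha
  rw [C.hq, Nat.cast_pow, CharP.cast_eq_zero, zero_pow (by omega)]

lemma cardT (C : Crv p a q t K R x y z) [IsAlgClosed K] [CharP K p] : Nat.card (TT K q t) = q ^ 3 * (q ^ 2 - 1) * t := by
  have q2 := C.q2
  have hqq : q + 1 < q ^ 2 := by nlinarith
  have hq0 : (q : K) = 0 := C.castq
  have ht0 : (t : K) ≠ 0 := by
    rw [Ne, CharP.cast_eq_zero_iff K p]
    intro h
    have := Nat.dvd_gcd h dvd_rfl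
    rw [C.cop] at this
    exact C.hp.one_lt.ne' (Nat.dvd_one.1 this)
  have c1 : Nat.card {c : K // c ^ (t * (q ^ 2 - 1)) = 1} = t * (q ^ 2 - 1) := by
    have hN : t * (q ^ 2 - 1) ≠ 0 := Nat.mul_ne_zero C.ht.ne' (by omega)
    rw [card_roots_sep (Polynomial.X ^ (t * (q ^ 2 - 1)) - 1), ← Polynomial.C_1, Polynomial.natDegree_X_pow_sub_C]
    · rw [X_pow_sub_one_separable_iff]
      rw [Nat.cast_mul, Nat.cast_sub (by omega), Nat.cast_pow, hq0]
      simpa using ht0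
    · intro u; simp [sub_eq_zero]
  have c2 : Nat.card {b : K // b ^ (q ^ 2) = b} = q ^ 2 := by
    have hd : (Polynomial.X : K[X]).natDegree < (Polynomial.X ^ (q ^ 2) : K[X]).natDegree := by
      rw [Polynomial.natDegree_X, Polynomial.natDegree_X_pow]; omega
    rw [card_roots_sep (Polynomial.X ^ (q ^ 2) - Polynomial.X), Polynomial.natDegree_sub_eq_left_of_natDegree_lt hd, Polynomial.natDegree_X_pow]
    · apply sep_of_deriv _ (-1) (by simp)
      simp [derivative_X_pow, hq0]
    · intro u; simp [sub_eq_zero]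
  have c3 : ∀ d : K, Nat.card {γ : K // γ ^ q + γ = d} = q := by
    intro d
    have hd : (Polynomial.X : K[X]).natDegree < (Polynomial.X ^ q : K[X]).natDegree := by
      rw [Polynomial.natDegree_X, Polynomial.natDegree_X_pow]; omega
    rw [card_roots_sep (Polynomial.X ^ q + Polynomial.X - Polynomial.C d), Polynomial.natDegree_sub_C,
      Polynomial.natDegree_add_eq_left_of_natDegree_lt hd, Polynomial.natDegree_X_pow]
    · apply sep_of_deriv _ 1 (by simp)
      simp [derivative_X_pow, hq0]
    · intro u; simp [sub_eq_zero]
  have f2 : Finite {b : K // b ^ (q ^ 2) = b} :=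
    Nat.finite_of_card_ne_zero (by rw [c2]; positivity)
  have f3 : ∀ d : K, Finite {γ : K // γ ^ q + γ = d} := fun d =>
    Nat.finite_of_card_ne_zero (by rw [c3]; omega)
  have := Fintype.ofFinite {b : K // b ^ (q ^ 2) = b}
  rw [TT, Nat.card_prod, c1, Nat.card_sigma]
  simp only [c3]
  rw [Finset.sum_const, Finset.card_univ, ← Nat.card_eq_fintype_card, c2, smul_eq_mul]
  ring

lemma noeth (C : Crv p a q t K R x y z) : IsNoetherianRing R := by
  classical
  have : Algebra.FiniteType K R := ⟨⟨{x, y, z}, by simpa using C.gen⟩⟩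
  exact Algebra.FiniteType.isNoetherianRing K R

lemma mkAut (C : Crv p a q t K R x y z) [CharP K p] [Nontrivial R]
    (univ : ∀ x' y' z' : R, z' ^ t = y' ^ (q ^ 2) - y' → y' ^ (q + 1) = x' ^ q + x' →
      ∃ φ : R →ₐ[K] R, φ x = x' ∧ φ y = y' ∧ φ z = z') (c b γ : K)
    (hc : c ^ (t * (q ^ 2 - 1)) = 1) (hb : b ^ (q ^ 2) = b) (hγ : γ ^ q + γ = b ^ (q + 1)) :
    ∃ σ : R ≃ₐ[K] R, σ z = c • z ∧ σ y = c ^ t • y + algebraMap K R b ∧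
      σ x = c ^ (t * (q + 1)) • x + (c ^ t * b ^ q) • y + algebraMap K R γ := by
  have q2 := C.q2
  have hqq : q + 1 < q ^ 2 := by nlinarith
  have : Fact p.Prime := ⟨C.hp⟩
  have : CharP R p := charP_of_injective_algebraMap (FaithfulSMul.algebraMap_injective K R) p
  have frob : ∀ u w : R, (u + w) ^ q = u ^ q + w ^ q := by
    intro u w; rw [C.hq]; exact add_pow_char_pow ..
  have frob2 : ∀ u w : R, (u + w) ^ (q ^ 2) = u ^ (q ^ 2) + w ^ (q ^ 2) := by
    intro u w; rw [sq, pow_mul, frob, frob, ← pow_mul, ← pow_mul]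
  have hc0 : c ≠ 0 := by
    rintro rfl
    rw [zero_pow (Nat.mul_ne_zero C.ht.ne' (by omega))] at hc
    exact zero_ne_one hc
  set a' := c ^ t with ha'
  have ha1 : a' ^ (q ^ 2 - 1) = 1 := by rw [ha', ← pow_mul, hc]
  have ha2 : a' ^ (q ^ 2) = a' := by
    have : q ^ 2 = (q ^ 2 - 1) + 1 := by omega
    rw [this, pow_succ, ha1, one_mul]
  have ha0 : a' ≠ 0 := pow_ne_zero _ hc0
  set A := algebraMap K R a' with hA
  set Bb := algebraMap K R b with hBb
  set Gg := algebraMap K R γ with hGg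
  have hA2 : A ^ (q ^ 2) = A := by rw [hA, ← map_pow, ha2]
  have hA2' : (A ^ q) ^ q = A := by rw [← pow_mul, ← sq, hA2]
  have hB2 : Bb ^ (q ^ 2) = Bb := by rw [hBb, ← map_pow, hb]
  have hB2' : (Bb ^ q) ^ q = Bb := by rw [← pow_mul, ← sq, hB2]
  have hG2 : Gg ^ q + Gg = Bb ^ q * Bb := by
    rw [hGg, hBb, ← map_pow, ← map_pow, ← map_add, hγ, pow_succ, map_mul]
  have e2 : y ^ q * y = x ^ q + x := by rw [← pow_succ, C.e2]
  obtain ⟨φ, hx, hy, hz⟩ := univ (A ^ q * A * x + A * Bb ^ q * y + Gg) (A * y + Bb)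
    (algebraMap K R c * z) (by
      rw [mul_pow, ← map_pow, ← ha', C.e1, frob2, mul_pow, hA2, hB2]; ring) (by
      rw [pow_succ, frob, frob, frob]
      simp only [mul_pow]
      rw [hA2', hB2']
      linear_combination A ^ q * A * e2 - hG2)
  have hsurj : Function.Surjective φ := by
    rw [← AlgHom.range_eq_top, eq_top_iff, ← C.gen]
    have mz : z ∈ φ.range := by
      have : z = c⁻¹ • φ z := by
        rw [hz, ← Algebra.smul_def, smul_smul, inv_mul_cancel₀ hc0, one_smul]
      rw [this]; exact φ.range.smul_mem ⟨z, rfl⟩ _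
    have my : y ∈ φ.range := by
      have : y = a'⁻¹ • (φ y - algebraMap K R b) := by
        rw [hy, add_sub_cancel_right, hA, ← Algebra.smul_def, smul_smul, inv_mul_cancel₀ ha0, one_smul]
      rw [this]; exact φ.range.smul_mem (sub_mem ⟨y, rfl⟩ (φ.range.algebraMap_mem _)) _
    have mx : x ∈ φ.range := by
      have : x = (a' ^ q * a')⁻¹ • (φ x - A * Bb ^ q * y - algebraMap K R γ) := by
        have h3 : φ x - A * Bb ^ q * y - algebraMap K R γ = (a' ^ q * a') • x := by
          rw [hx, Algebra.smul_def, map_mul, map_pow]; ring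
        rw [h3, smul_smul, inv_mul_cancel₀ (mul_ne_zero (pow_ne_zero _ ha0) ha0), one_smul]
      rw [this]
      refine φ.range.smul_mem (sub_mem (sub_mem ⟨x, rfl⟩ ?_) (φ.range.algebraMap_mem _)) _
      exact mul_mem (mul_mem (φ.range.algebraMap_mem _) (pow_mem (φ.range.algebraMap_mem _) _)) my
    rw [Algebra.adjoin_le_iff]
    rintro f (rfl | rfl | rfl)
    · exact mx
    · exact my
    · exact mz
  have := C.noeth
  have hinj : Function.Injective φ := noeth_inj (φ : R →+* R) hsurj
  refine ⟨AlgEquiv.ofBijective φ ⟨hinj, hsurj⟩, ?_, ?_, ?_⟩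
  · change φ z = _
    rw [hz, Algebra.smul_def]
  · change φ y = _
    rw [hy, Algebra.smul_def]
  · change φ x = _
    rw [hx, pow_mul, ← ha', Algebra.smul_def, Algebra.smul_def, pow_succ]
    simp only [map_mul, map_pow]
    rw [← hA, ← hBb]

lemma cardAut (C : Crv p a q t K R x y z) [IsAlgClosed K] [IsDomain R] [CharP K p] (g : Gd K z v)
    (univ : ∀ x' y' z' : R, z' ^ t = y' ^ (q ^ 2) - y' → y' ^ (q + 1) = x' ^ q + x' →
      ∃ φ : R →ₐ[K] R, φ x = x' ∧ φ y = y' ∧ φ z = z') :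
    Nat.card (R ≃ₐ[K] R) = q ^ 3 * (q ^ 2 - 1) * t := by
  rw [← C.cardT (K := K)]
  have hz0 : z ≠ 0 := by
    rintro h
    have := g.hz
    rw [h, map_zero] at this
    exact absurd this (not_lt.2 zero_le_one)
  have H : ∀ w : TT K q t, ∃ σ : R ≃ₐ[K] R, σ z = w.1.1 • z ∧
      σ y = w.1.1 ^ t • y + algebraMap K R w.2.1.1 ∧
      σ x = w.1.1 ^ (t * (q + 1)) • x + (w.1.1 ^ t * w.2.1.1 ^ q) • y + algebraMap K R w.2.2.1 :=
    fun w => C.mkAut univ w.1.1 w.2.1.1 w.2.2.1 w.1.2 w.2.1.2 w.2.2.2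
  choose Φ h1 h2 h3 using H
  symm
  have inj := FaithfulSMul.algebraMap_injective K R
  refine Nat.card_eq_of_bijective Φ ⟨?_, ?_⟩
  · rintro ⟨⟨c, hc⟩, ⟨b, hb⟩, γ, hγ⟩ ⟨⟨c', hc'⟩, ⟨b', hb'⟩, γ', hγ'⟩ hw
    have e1 := h1 ⟨⟨c, hc⟩, ⟨b, hb⟩, γ, hγ⟩
    rw [hw, h1] at e1
    have e2 := h2 ⟨⟨c, hc⟩, ⟨b, hb⟩, γ, hγ⟩
    rw [hw, h2] at e2
    have e3 := h3 ⟨⟨c, hc⟩, ⟨b, hb⟩, γ, hγ⟩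
    rw [hw, h3] at e3
    simp only [Algebra.smul_def] at e1 e2 e3
    have e1' : c' = c := inj (mul_right_cancel₀ hz0 e1)
    subst e1'
    have e2' : b' = b := inj (add_left_cancel e2)
    subst e2'
    have e3' : γ' = γ := inj (add_left_cancel e3)
    subst e3'
    rfl
  · intro σ
    obtain ⟨c, b, γ, hc, hb, hγ, s1, s2, s3⟩ := C.classify g σ
    refine ⟨⟨⟨c, hc⟩, ⟨b, hb⟩, γ, hγ⟩, ?_⟩
    have : ((Φ ⟨⟨c, hc⟩, ⟨b, hb⟩, γ, hγ⟩ : R ≃ₐ[K] R) : R →ₐ[K] R) = (σ : R →ₐ[K] R) := by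
      apply AlgHom.ext_of_adjoin_eq_top C.gen
      rintro f (rfl | rfl | rfl)
      · rw [AlgEquiv.coe_toAlgHom, AlgEquiv.coe_toAlgHom, h3, s3]
      · rw [AlgEquiv.coe_toAlgHom, AlgEquiv.coe_toAlgHom, h2, s2]
      · rw [AlgEquiv.coe_toAlgHom, AlgEquiv.coe_toAlgHom, h1, s1]
    ext f
    exact DFunLike.congr_fun this f

end Crv
end

section
open Polynomial

lemma int_y {B S : Type} [CommRing B] [CommRing S] [Algebra B S] {q : ℕ} (hq : 2 ≤ q) {y w : S}
    (hw : IsIntegral B w) (e1 : w = y ^ (q ^ 2) - y) : IsIntegral B y := by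
  nontriviality B
  have h1 : (Polynomial.X : B[X]).degree < ((q ^ 2 : ℕ) : WithBot ℕ) := by
    rw [Polynomial.degree_X]
    have : 1 < q ^ 2 := by nlinarith
    exact_mod_cast this
  have hm : (Polynomial.X ^ (q ^ 2) - Polynomial.X : B[X]).Monic := Polynomial.monic_X_pow_sub (by
    rw [Polynomial.degree_X]
    have : 1 < q ^ 2 := by nlinarith
    exact_mod_cast this)
  refine IsIntegral.of_aeval_monic hm ?_ ?_
  · rw [Polynomial.natDegree_sub_eq_left_of_natDegree_lt]
    · rw [Polynomial.natDegree_X_pow]; positivity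
    · rw [Polynomial.natDegree_X_pow, Polynomial.natDegree_X]; nlinarith
  · simpa [← e1] using hw

lemma int_x {B S : Type} [CommRing B] [CommRing S] [Algebra B S] {q : ℕ} (hq : 2 ≤ q) {x w : S}
    (hw : IsIntegral B w) (e1 : w = x ^ q + x) : IsIntegral B x := by
  nontriviality B
  have hm : (Polynomial.X ^ q + Polynomial.X : B[X]).Monic := Polynomial.monic_X_pow_add (by
    rw [Polynomial.degree_X]
    have : 1 < q := by omega
    exact_mod_cast this)
  refine IsIntegral.of_aeval_monic hm ?_ ?_
  · rw [Polynomial.natDegree_add_eq_left_of_natDegree_lt]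
    · rw [Polynomial.natDegree_X_pow]; positivity
    · rw [Polynomial.natDegree_X_pow, Polynomial.natDegree_X]; omega
  · simpa [← e1] using hw

namespace Crv
variable {p a q t : ℕ} {K R : Type} [Field K] [CommRing R] [Algebra K R] {x y z : R}

lemma red (C : Crv p a q t K R x y z) [IsAlgClosed K] [CharP K p] (z0 : K) (g : R) (n : ℕ)
    (h : g ^ n ∈ Ideal.span {z - algebraMap K R z0}) : g ∈ Ideal.span {z - algebraMap K R z0} := by
  set I := Ideal.span {z - algebraMap K R z0} with hI
  by_cases hT : I = ⊤
  · rw [hT]; trivial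
  have := C.noeth
  have : Nontrivial (R ⧸ I) := Ideal.Quotient.nontrivial_iff.mpr hT
  have : CharP (R ⧸ I) p := charP_of_injective_algebraMap (algebraMap K (R ⧸ I)).injective p
  have : Fact p.Prime := ⟨C.hp⟩
  set π := Ideal.Quotient.mkₐ K I with hπ
  have hz : π z = algebraMap K (R ⧸ I) z0 := by
    have : π (z - algebraMap K R z0) = 0 :=
      Ideal.Quotient.eq_zero_iff_mem.mpr (Ideal.mem_span_singleton_self _)
    rw [map_sub, sub_eq_zero, AlgHom.commutes] at this
    exact this
  have hKr : ∀ c : K, algebraMap K (R ⧸ I) c ∈ (frobenius (R ⧸ I) p).range := by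
    intro c
    obtain ⟨d, hd⟩ := IsAlgClosed.exists_pow_nat_eq c C.hp.pos
    exact ⟨algebraMap K _ d, by rw [frobenius_def, ← map_pow, hd]⟩
  have hqp : ∀ u : R ⧸ I, ∀ k : ℕ, 0 < k → u ^ (q ^ k) ∈ (frobenius (R ⧸ I) p).range := by
    intro u k hk
    refine ⟨u ^ (p ^ (a * k - 1)), ?_⟩
    rw [frobenius_def, ← pow_mul, ← pow_succ, C.hq, ← pow_mul]
    have : 0 < a * k := Nat.mul_pos C.ha hk
    rw [Nat.sub_add_cancel (by omega)]
  have hy : π y ∈ (frobenius (R ⧸ I) p).range := by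
    have e : π y = π y ^ (q ^ 2) - algebraMap K _ (z0 ^ t) := by
      rw [map_pow, ← hz, ← map_pow, ← map_pow, C.e1]; simp
    rw [e]
    exact Subring.sub_mem _ (hqp _ 2 (by norm_num)) (hKr _)
  have hx : π x ∈ (frobenius (R ⧸ I) p).range := by
    have e : π x = π y ^ (q + 1) - π x ^ (q ^ 1) := by
      rw [← map_pow, C.e2]; simp
    rw [e]
    exact Subring.sub_mem _ (Subring.pow_mem _ hy _) (hqp _ 1 (by norm_num))
  have hall : ∀ r : R, π r ∈ (frobenius (R ⧸ I) p).range := by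
    intro r
    have hr : r ∈ Algebra.adjoin K ({x, y, z} : Set R) := by rw [C.gen]; trivial
    induction hr using Algebra.adjoin_induction with
    | mem u hu =>
      rcases hu with rfl | rfl | rfl
      · exact hx
      · exact hy
      · rw [hz]; exact hKr _
    | algebraMap c => rw [AlgHom.commutes]; exact hKr c
    | add u v _ _ h1 h2 => rw [map_add]; exact Subring.add_mem _ h1 h2
    | mul u v _ _ h1 h2 => rw [map_mul]; exact Subring.mul_mem _ h1 h2
  have hs : Function.Surjective (frobenius (R ⧸ I) p) := by
    intro u
    obtain ⟨r, rfl⟩ := Ideal.Quotient.mk_surjective u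
    exact hall r
  have hinj := noeth_inj _ hs
  have hit : Function.Injective (frobenius (R ⧸ I) p)^[n] := hinj.iterate n
  rw [← Ideal.Quotient.eq_zero_iff_mem] at h ⊢
  apply hit
  rw [iterate_map_zero, iterate_frobenius]
  have hn : n ≤ p ^ n := (Nat.lt_pow_self C.hp.one_lt).le
  exact pow_eq_zero_of_le hn (by rw [← map_pow]; exact h)

variable {F : Type} [Field F] [Algebra R F] [Algebra K F] [IsScalarTower K R F]

lemma onestep [IsDomain R] [IsFractionRing R F] (C : Crv p a q t K R x y z) [IsAlgClosed K] [CharP K p] (z0 : K)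
    (hz0 : z - algebraMap K R z0 ≠ 0)
    (f : F) (hf : IsIntegral R f)
    (h : algebraMap R F (z - algebraMap K R z0) * f ∈ (algebraMap R F).range) :
    f ∈ (algebraMap R F).range := by
  obtain ⟨g, hg⟩ := h
  obtain ⟨P, hP, hPf⟩ := hf
  have h1 := Polynomial.scaleRoots_aeval_eq_zero (r := z - algebraMap K R z0) (a := f) (p := P) hPf
  rw [← hg, Polynomial.aeval_algebraMap_apply] at h1
  have hinj := IsFractionRing.injective R F
  have h2 := (map_eq_zero_iff _ hinj).mp h1
  have hgI : g ^ P.natDegree ∈ Ideal.span {z - algebraMap K R z0} := by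
    rw [Polynomial.coe_aeval_eq_eval, Polynomial.eval_eq_sum_range, Polynomial.natDegree_scaleRoots,
      Finset.sum_range_succ, coeff_scaleRoots_natDegree, hP.leadingCoeff, one_mul] at h2
    rw [eq_neg_of_add_eq_zero_right h2]
    refine neg_mem (Ideal.sum_mem _ fun i hi => ?_)
    rw [coeff_scaleRoots]
    refine Ideal.mul_mem_right _ _ (Ideal.mul_mem_left _ _ ?_)
    refine Ideal.pow_mem_of_mem _ (Ideal.mem_span_singleton_self _) _ ?_
    have := Finset.mem_range.mp hi
    omega
  obtain ⟨u, hu⟩ := Ideal.mem_span_singleton'.mp (C.red z0 g _ hgI)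
  refine ⟨u, ?_⟩
  have h0 : algebraMap R F (z - algebraMap K R z0) ≠ 0 := by
    rwa [Ne, map_eq_zero_iff _ hinj]
  apply mul_left_cancel₀ h0
  rw [← hg, ← hu, map_mul, mul_comm]

lemma multistep [IsDomain R] [IsFractionRing R F] (C : Crv p a q t K R x y z) [IsAlgClosed K] [CharP K p]
    (htr : Transcendental K z) : ∀ (n : ℕ) (P : K[X]), P.natDegree = n → P ≠ 0 →
    ∀ f : F, IsIntegral R f →
    algebraMap R F (Polynomial.aeval z P) * f ∈ (algebraMap R F).range → f ∈ (algebraMap R F).range := by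
  intro n
  induction n with
  | zero =>
    intro P hn hP f hf h
    rw [Polynomial.natDegree_eq_zero] at hn
    obtain ⟨c, rfl⟩ := hn
    have hc : c ≠ 0 := by rintro rfl; simp at hP
    obtain ⟨g, hg⟩ := h
    refine ⟨algebraMap K R c⁻¹ * g, ?_⟩
    rw [map_mul, hg, Polynomial.aeval_C, ← mul_assoc, ← map_mul, ← map_mul, inv_mul_cancel₀ hc]
    simp
  | succ n ih =>
    intro P hn hP f hf h
    obtain ⟨r, hr⟩ := IsAlgClosed.exists_root P (by
      rw [Polynomial.degree_eq_natDegree hP, hn]; exact_mod_cast Nat.succ_ne_zero n)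
    obtain ⟨Q, rfl⟩ := dvd_iff_isRoot.mpr hr
    have hQ : Q ≠ 0 := by rintro rfl; simp at hP
    rw [Polynomial.natDegree_mul (X_sub_C_ne_zero r) hQ, Polynomial.natDegree_X_sub_C] at hn
    refine ih Q (by omega) hQ f hf ?_
    refine C.onestep r ?_ _ (IsIntegral.mul isIntegral_algebraMap hf) ?_
    · intro h0
      apply htr
      refine ⟨Polynomial.X - Polynomial.C r, X_sub_C_ne_zero r, by simpa using h0⟩
    · rw [map_mul, map_mul, mul_assoc] at h
      simpa using h

lemma intcl [IsDomain R] [IsFractionRing R F] (C : Crv p a q t K R x y z) [IsAlgClosed K] [CharP K p]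
    (htr : Transcendental K z) (f : F) :
    IsIntegral (Algebra.adjoin K ({algebraMap R F z} : Set F)) f ↔ f ∈ (algebraMap R F).range := by
  constructor
  · intro hf
    have hfR : IsIntegral R f := by
      have hle : ∀ u ∈ Algebra.adjoin K ({algebraMap R F z} : Set F), u ∈ (IsScalarTower.toAlgHom K R F).range := by
        intro u hu
        refine Algebra.adjoin_le ?_ hu
        rintro _ rfl
        exact ⟨z, rfl⟩
      have h1 : IsIntegral ((IsScalarTower.toAlgHom K R F).range) f := by
        obtain ⟨P, hP, h⟩ := hf
        refine ⟨P.map (Subalgebra.inclusion (show Algebra.adjoin K ({algebraMap R F z} : Set F) ≤ (IsScalarTower.toAlgHom K R F).range from hle)).toRingHom, hP.map _, ?_⟩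
        rw [Polynomial.eval₂_map]
        exact h
      obtain ⟨P, hP, h⟩ := h1
      have hsur : Function.Surjective (IsScalarTower.toAlgHom K R F).rangeRestrict :=
        AlgHom.rangeRestrict_surjective _
      have hl : P ∈ Polynomial.lifts ((IsScalarTower.toAlgHom K R F).rangeRestrict : R →+* _) := by
        rw [Polynomial.lifts_iff_coeff_lifts]
        intro n
        exact hsur _
      obtain ⟨Q, hQ, _, hQm⟩ := Polynomial.lifts_and_degree_eq_and_monic hl hP
      refine ⟨Q, hQm, ?_⟩
      rw [← hQ, Polynomial.eval₂_map] at h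
      exact h
    obtain ⟨r, s, hs, rfl⟩ := IsFractionRing.div_surjective (A := R) f
    let : Algebra K[X] R := (Polynomial.aeval z).toAlgebra
    have am : ∀ P : K[X], algebraMap K[X] R P = Polynomial.aeval z P := fun P => rfl
    have iz : IsIntegral K[X] z := by
      have : z = algebraMap K[X] R Polynomial.X := by rw [am, Polynomial.aeval_X]
      rw [this]; exact isIntegral_algebraMap
    have iy := int_y C.q2 (iz.pow t) C.e1
    have ix := int_x C.q2 (iy.pow (q + 1)) C.e2
    have is : IsIntegral K[X] s := by
      have hr : s ∈ Algebra.adjoin K ({x, y, z} : Set R) := by rw [C.gen]; trivial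
      clear hs hf hfR
      induction hr using Algebra.adjoin_induction with
      | mem u hu =>
        rcases hu with rfl | rfl | rfl
        · exact ix
        · exact iy
        · exact iz
      | algebraMap c =>
        have : algebraMap K R c = algebraMap K[X] R (Polynomial.C c) := by rw [am, Polynomial.aeval_C]
        rw [this]; exact isIntegral_algebraMap
      | add u v _ _ h1 h2 => exact h1.add h2
      | mul u v _ _ h1 h2 => exact h1.mul h2
    obtain ⟨P, hP, d, hd⟩ := IsAlgebraic.exists_nonzero_dvd is.isAlgebraic hs
    refine C.multistep htr _ P rfl hP _ hfR ⟨d * r, ?_⟩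
    rw [am] at hd
    have hs0 : algebraMap R F s ≠ 0 := by
      rw [Ne, map_eq_zero_iff _ (IsFractionRing.injective R F)]
      exact nonZeroDivisors.ne_zero hs
    rw [hd]
    simp only [map_mul]
    field_simp
  · rintro ⟨r, rfl⟩
    set B := Algebra.adjoin K ({algebraMap R F z} : Set F)
    have iz : IsIntegral B (algebraMap R F z) :=
      isIntegral_algebraMap (x := (⟨_, Algebra.self_mem_adjoin_singleton K _⟩ : B))
    have iy : IsIntegral B (algebraMap R F y) :=
      int_y C.q2 (iz.pow t) (by rw [← map_pow, C.e1, map_sub, map_pow])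
    have ix : IsIntegral B (algebraMap R F x) :=
      int_x C.q2 (iy.pow (q + 1)) (by rw [← map_pow, C.e2, map_add, map_pow])
    have hr : r ∈ Algebra.adjoin K ({x, y, z} : Set R) := by rw [C.gen]; trivial
    induction hr using Algebra.adjoin_induction with
    | mem u hu =>
      rcases hu with rfl | rfl | rfl
      · exact ix
      · exact iy
      · exact iz
    | algebraMap c =>
      rw [← IsScalarTower.algebraMap_apply K R F, IsScalarTower.algebraMap_apply K B F]
      exact isIntegral_algebraMap
    | add u v _ _ h1 h2 => rw [map_add]; exact h1.add h2
    | mul u v _ _ h1 h2 => rw [map_mul]; exact h1.mul h2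

lemma htr [IsDomain R] (C : Crv p a q t K R x y z) [IsAlgClosed K]
    (pts : ∀ x' y' z' : K, z' ^ t = y' ^ (q ^ 2) - y' → y' ^ (q + 1) = x' ^ q + x' →
      ∃ φ : R →ₐ[K] K, φ x = x' ∧ φ y = y' ∧ φ z = z') : Transcendental K z := by
  intro hz
  have hq := C.q2
  obtain ⟨z0, rfl⟩ := alg_mem (K := K) z hz
  have hy : IsIntegral K y := int_y C.q2 (isIntegral_algebraMap (x := z0 ^ t)) (by rw [map_pow]; exact C.e1)
  obtain ⟨y0, rfl⟩ := alg_mem (K := K) y hy.isAlgebraic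
  obtain ⟨φ, -, h1, -⟩ := pts 0 0 0 (by
      rw [zero_pow C.ht.ne', zero_pow (by positivity), sub_zero]) (by
      rw [zero_pow (by omega), zero_pow (by omega), zero_add])
  obtain ⟨x1, hx1⟩ := IsAlgClosed.exists_root (Polynomial.X ^ q + Polynomial.X - 1 : K[X]) (by
    have : (Polynomial.X ^ q + Polynomial.X - 1 : K[X]) = Polynomial.X ^ q + (Polynomial.X - 1) := by ring
    have h2 : (Polynomial.X - 1 : K[X]).degree < (Polynomial.X ^ q : K[X]).degree := by
      rw [show (1 : K[X]) = Polynomial.C 1 by simp, Polynomial.degree_X_sub_C, Polynomial.degree_X_pow]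
      exact_mod_cast (by omega : 1 < q)
    rw [this, Polynomial.degree_add_eq_left_of_degree_lt h2, Polynomial.degree_X_pow]
    exact_mod_cast (by omega : q ≠ 0))
  obtain ⟨ψ, -, h2, -⟩ := pts x1 1 0 (by
      rw [zero_pow C.ht.ne', one_pow, sub_self]) (by
      simp only [IsRoot, Polynomial.eval_sub, Polynomial.eval_add, Polynomial.eval_pow, Polynomial.eval_X, Polynomial.eval_one] at hx1
      rw [one_pow]; linear_combination -hx1)
  rw [AlgHom.commutes] at h1 h2
  exact zero_ne_one (h1.symm.trans h2)

lemma exGd [IsDomain R] [IsFractionRing R F] (htr : Transcendental K z) :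
    ∃ (G : Type) (_ : LinearOrderedCommGroupWithZero G) (v : Valuation R G), Gd K z v := by
  have hzn : algebraMap R F z ∉ (integralClosure K F).toSubring := by
    intro h
    have h1 : IsIntegral K (algebraMap R F z) := h
    apply htr
    exact ((isIntegral_algebraMap_iff (IsFractionRing.injective R F)).mp h1).isAlgebraic
  have : IsIntegrallyClosedIn (integralClosure K F).toSubring F :=
    inferInstanceAs (IsIntegrallyClosedIn (integralClosure K F) F)
  obtain ⟨V, hV, hzV⟩ := Subring.exists_le_valuationSubring_of_isIntegrallyClosedIn hzn
  refine ⟨_, inferInstance, V.valuation.comap (algebraMap R F), ?_, ?_⟩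
  · have hle : ∀ c : K, V.valuation (algebraMap K F c) ≤ 1 := by
      intro c
      rw [ValuationSubring.valuation_le_one_iff]
      exact hV (show IsIntegral K (algebraMap K F c) from isIntegral_algebraMap)
    intro c hc
    rw [Valuation.comap_apply, ← IsScalarTower.algebraMap_apply K R F]
    refine le_antisymm (hle c) ?_
    have h1 := hle c⁻¹
    have hc' : V.valuation (algebraMap K F c) ≠ 0 := by simpa using hc
    rw [map_inv₀, map_inv₀] at h1
    exact (inv_le_one₀ (zero_lt_iff.mpr hc')).mp h1
  · rw [Valuation.comap_apply, ← not_le, ValuationSubring.valuation_le_one_iff]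
    exact hzV
end Crv

lemma cardStab {K R F : Type} [Field K] [CommRing R] [IsDomain R] [Algebra K R] [Field F] [Algebra R F]
    [Algebra K F] [IsScalarTower K R F] [IsFractionRing R F] (A : Set F)
    (hA : ∀ f, f ∈ A ↔ f ∈ (algebraMap R F).range) :
    ∃ H : Subgroup (F ≃ₐ[K] F), (H : Set (F ≃ₐ[K] F)) = {σ : F ≃ₐ[K] F | ⇑σ '' A = A} ∧
      Nat.card H = Nat.card (R ≃ₐ[K] R) := by
  have hinj := IsFractionRing.injective R F
  let H : Subgroup (F ≃ₐ[K] F) :=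
    { carrier := {σ : F ≃ₐ[K] F | ⇑σ '' A = A}
      mul_mem' := by
        intro σ τ hσ hτ
        change _ '' A = A at hσ hτ
        change (⇑σ ∘ ⇑τ) '' A = A
        rw [Set.image_comp, hτ, hσ]
      one_mem' := Set.image_id A
      inv_mem' := by
        intro σ hσ
        change _ '' A = A at hσ ⊢
        conv_lhs => rw [← hσ]
        rw [← Set.image_comp]
        have : (⇑σ⁻¹ ∘ ⇑σ) = id := funext fun u => σ.symm_apply_apply u
        rw [this, Set.image_id] }
  refine ⟨H, rfl, ?_⟩
  symm
  have key : ∀ τ : R ≃ₐ[K] R, IsFractionRing.algEquivOfAlgEquiv (R := K) (K := F) (L := F) τ ∈ H := by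
    intro τ
    change _ '' A = A
    ext f
    constructor
    · rintro ⟨g, hg, rfl⟩
      obtain ⟨r, rfl⟩ := (hA g).mp hg
      rw [hA]
      exact ⟨τ r, by simp⟩
    · intro hf
      obtain ⟨r, rfl⟩ := (hA f).mp hf
      exact ⟨algebraMap R F (τ.symm r), (hA _).mpr ⟨_, rfl⟩, by simp⟩
  refine Nat.card_congr (Equiv.ofBijective (fun τ => (⟨_, key τ⟩ : H)) ⟨?_, ?_⟩)
  · intro τ τ' h
    have h' := congrArg Subtype.val h
    ext r
    apply hinj
    have := DFunLike.congr_fun h' (algebraMap R F r)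
    simpa using this
  · rintro ⟨σ, hσ⟩
    have hσ' : ⇑σ '' A = A := hσ
    have h1 : ∀ r : R, ∃ u : R, algebraMap R F u = σ (algebraMap R F r) := by
      intro r
      have : σ (algebraMap R F r) ∈ A := by
        rw [← hσ']; exact ⟨_, (hA _).mpr ⟨r, rfl⟩, rfl⟩
      exact (hA _).mp this
    have h2 : ∀ r : R, ∃ u : R, σ (algebraMap R F u) = algebraMap R F r := by
      intro r
      have : algebraMap R F r ∈ ⇑σ '' A := by
        rw [hσ']; exact (hA _).mpr ⟨r, rfl⟩
      obtain ⟨g, hg, hgr⟩ := this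
      obtain ⟨u, rfl⟩ := (hA g).mp hg
      exact ⟨u, hgr⟩
    choose T hT using h1
    let φ : R →ₐ[K] R :=
      { toFun := T
        map_one' := by apply hinj; rw [hT]; simp
        map_mul' := by intro u v; apply hinj; simp [hT]
        map_zero' := by apply hinj; rw [hT]; simp
        map_add' := by intro u v; apply hinj; simp [hT]
        commutes' := by
          intro c
          apply hinj
          rw [hT, ← IsScalarTower.algebraMap_apply K R F, AlgEquiv.commutes] }
    have hφ : Function.Bijective φ := by
      constructor
      · intro u v h
        apply hinj
        apply σ.injective
        rw [← hT, ← hT]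
        exact congrArg _ h
      · intro r
        obtain ⟨u, hu⟩ := h2 r
        refine ⟨u, hinj ?_⟩
        rw [← hu]
        exact hT u
    refine ⟨AlgEquiv.ofBijective φ hφ, ?_⟩
    apply Subtype.ext
    ext f
    obtain ⟨r, s, hs, rfl⟩ := IsFractionRing.div_surjective (A := R) f
    have e : ∀ r : R, IsFractionRing.algEquivOfAlgEquiv (R := K) (K := F) (L := F)
        (AlgEquiv.ofBijective φ hφ) (algebraMap R F r) = σ (algebraMap R F r) := by
      intro r
      rw [IsFractionRing.algEquivOfAlgEquiv_algebraMap]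
      exact hT r
    simp only [map_div₀, e]

end

set_option synthInstance.maxHeartbeats 1000000 in
set_option maxHeartbeats 2000000 in
/-- universal property of the coordinate ring -/
lemma YRing_univ (K : Type) [Field K] (q t : ℕ) (S : Type) [CommRing S] [Algebra K S] (x' y' z' : S)
    (h1 : z' ^ t = y' ^ (q ^ 2) - y') (h2 : y' ^ (q + 1) = x' ^ q + x') :
    ∃ φ : YRing K q t →ₐ[K] S, φ (Ideal.Quotient.mk _ (X 0)) = x' ∧
      φ (Ideal.Quotient.mk _ (X 1)) = y' ∧ φ (Ideal.Quotient.mk _ (X 2)) = z' := by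
  have hle : YIdeal K q t ≤ RingHom.ker (MvPolynomial.aeval (R := K) ![x', y', z']) := by
    unfold YIdeal
    rw [Ideal.span_le]
    rintro u (rfl | rfl)
    · simp [RingHom.mem_ker, h1]
    · simp [RingHom.mem_ker, h2]
  have h0 : ∀ u ∈ YIdeal K q t, MvPolynomial.aeval (R := K) ![x', y', z'] u = 0 :=
    fun u hu => RingHom.mem_ker.mp (hle hu)
  have key : ∀ u, Ideal.Quotient.liftₐ (YIdeal K q t) (MvPolynomial.aeval (R := K) ![x', y', z']) h0
      (Ideal.Quotient.mk _ u) = MvPolynomial.aeval (R := K) ![x', y', z'] u := fun u => rfl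
  refine ⟨Ideal.Quotient.liftₐ _ (MvPolynomial.aeval (R := K) ![x', y', z']) h0, ?_, ?_, ?_⟩
  · exact (key _).trans (by simp)
  · exact (key _).trans (by simp)
  · exact (key _).trans (by simp)

set_option synthInstance.maxHeartbeats 1000000 in
set_option maxHeartbeats 2000000 in
lemma YRing_crv {p a q t : ℕ} (hp : p.Prime) (ha : 0 < a) (hq : q = p ^ a) (ht : 0 < t)
    (cop : Nat.Coprime t p) (K : Type) [Field K] :
    Crv p a q t K (YRing K q t) (Ideal.Quotient.mk _ (X 0)) (Ideal.Quotient.mk _ (X 1))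
      (Ideal.Quotient.mk _ (X 2)) := by
  refine ⟨hp, ha, hq, ht, cop, ?_, ?_, ?_⟩
  · simp only [← map_pow, ← map_sub]
    rw [Ideal.Quotient.eq]
    exact Ideal.subset_span (by simp)
  · simp only [← map_pow, ← map_add]
    rw [Ideal.Quotient.eq]
    exact Ideal.subset_span (by simp)
  · have h := congrArg (Subalgebra.map (Ideal.Quotient.mkₐ K (YIdeal K q t)))
      (MvPolynomial.adjoin_range_X (R := K) (σ := Fin 3))
    rw [AlgHom.map_adjoin, Algebra.map_top,
      (AlgHom.range_eq_top _).mpr (Ideal.Quotient.mkₐ_surjective K _)] at h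
    rw [← h]
    congr 1
    ext u
    simp only [Set.mem_insert_iff, Set.mem_singleton_iff, Set.mem_image, Set.mem_range,
      exists_exists_eq_and, Fin.exists_fin_succ, Fin.exists_fin_zero]
    simp [eq_comm]


set_option synthInstance.maxHeartbeats 1000000 in
set_option maxHeartbeats 2000000 in
/-- Theorem: let `A` be the integral closure of the polynomial ring `K[z]` in `F` (the ring
of functions of `Y_{n,s}` regular outside `P_∞`).  Then `{σ ∈ Aut(F/K) : σ(A) = A}` is a
subgroup of `Aut(F/K)` of order `q^3 (q^2-1) (m/s)` (the stabilizer of `P_∞`). -/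
theorem stmt3 (p a q n m s : ℕ) (hp : p.Prime) (ha : 0 < a) (hq : q = p ^ a)
    (hn : 3 ≤ n) (hodd : Odd n) (hm : m * (q + 1) = q ^ n + 1)
    (hs : s ∣ m) (hs0 : 0 < s) (hsm : s ≠ m)
    (K : Type) [Field K] [IsAlgClosed K] [CharP K p]
    [hI : (YIdeal K q (m / s)).IsPrime] :
    ∃ H : Subgroup (YField K q (m / s) ≃ₐ[K] YField K q (m / s)),
      (H : Set (YField K q (m / s) ≃ₐ[K] YField K q (m / s)))
        = {σ : YField K q (m / s) ≃ₐ[K] YField K q (m / s) | ⇑σ '' (integralClosure (Algebra.adjoin K ({Yz K q (m / s)} :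
              Set (YField K q (m / s)))) (YField K q (m / s)) : Set (YField K q (m / s)))
            = (integralClosure (Algebra.adjoin K ({Yz K q (m / s)} :
              Set (YField K q (m / s)))) (YField K q (m / s)) : Set (YField K q (m / s)))} ∧
      Nat.card H = q ^ 3 * (q ^ 2 - 1) * (m / s) := by
  have hq0 : 0 < q := by rw [hq]; exact pow_pos hp.pos _
  have hm0 : 0 < m := by
    rcases Nat.eq_zero_or_pos m with h | h
    · rw [h] at hm; omega
    · exact h
  have ht : 0 < m / s := Nat.div_pos (Nat.le_of_dvd hm0 hs) hs0
  have cop : Nat.Coprime (m / s) p := by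
    rw [Nat.coprime_comm, hp.coprime_iff_not_dvd]
    intro h
    have h1 : p ∣ q ^ n + 1 := by
      rw [← hm]
      exact (h.trans (Nat.div_dvd_of_dvd hs)).mul_right _
    have h2 : p ∣ q ^ n := by
      rw [hq, ← pow_mul]
      exact dvd_pow_self p (Nat.mul_pos ha (by omega)).ne'
    exact hp.one_lt.ne' (Nat.dvd_one.mp ((Nat.dvd_add_right h2).mp h1))
  generalize m / s = t at *
  have crv := YRing_crv hp ha hq ht cop K
  have htr := crv.htr (fun x' y' z' h1 h2 => YRing_univ K q t K x' y' z' h1 h2)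
  obtain ⟨G, _, v, hv⟩ := Crv.exGd (F := YField K q t) htr
  obtain ⟨H, hH, hc⟩ := cardStab (K := K) (R := YRing K q t) (F := YField K q t)
    (integralClosure (Algebra.adjoin K ({Yz K q t} : Set (YField K q t))) (YField K q t) :
      Set (YField K q t)) (fun f => crv.intcl htr f)
  refine ⟨H, hH, ?_⟩
  rw [hc]
  exact crv.cardAut hv (fun x' y' z' h1 h2 => YRing_univ K q t _ x' y' z' h1 h2)
end

section
/- The field extension F/K(y,z) is Galois of degree q, and the subgroup {σ ∈ Aut(F/K) : σ(y) = y and σ(z) = z} of Aut(F/K) is elementary abelian of order q and consists precisely of the automorphisms τ_c, for c ∈ K with c^{q^2} = c and c^q + c = 0, determined by τ_c(x) = x + c, τ_c(y) = y, τ_c(z) = z. -/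
open MvPolynomial

/-- The coordinate function `x ∈ F`, image of the variable `X`. -/
noncomputable def Yx (K : Type) [Field K] (q t : ℕ) : YField K q t :=
  algebraMap (YRing K q t) (YField K q t) (Ideal.Quotient.mk _ (X 0))

/-- The coordinate function `y ∈ F`, image of the variable `Y`. -/
noncomputable def Yy (K : Type) [Field K] (q t : ℕ) : YField K q t :=
  algebraMap (YRing K q t) (YField K q t) (Ideal.Quotient.mk _ (X 1))

theorem card_kernel_aux (p a q : ℕ) (hp : p.Prime) (ha : 0 < a) (hq : q = p ^ a)
    (K : Type) [Field K] [IsAlgClosed K] [CharP K p] :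
    Nat.card {c : K // c ^ q + c = 0} = q := by
  have hq1 : 1 < q := by rw [hq]; exact Nat.one_lt_pow ha.ne' hp.one_lt
  have hq0 : (q : K) = 0 := by
    rw [hq, Nat.cast_pow, CharP.cast_eq_zero, zero_pow ha.ne']
  let f : Polynomial K := Polynomial.X ^ q + Polynomial.X
  have hdeg : f.natDegree = q := by
    simp only [f]
    rw [Polynomial.natDegree_add_eq_left_of_natDegree_lt] <;> simp [hq1]
  have hf0 : f ≠ 0 := by
    intro h; rw [h] at hdeg; simp at hdeg; omega
  have hsep : f.Separable := by
    refine ⟨0, 1, ?_⟩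
    simp [f, Polynomial.derivative_X_pow, hq0]
  have h1 := Polynomial.card_rootSet_eq_natDegree (K := K) hsep (IsAlgClosed.splits_domain _)
  rw [hdeg, ← Nat.card_eq_fintype_card] at h1
  refine Eq.trans (Nat.card_congr (Equiv.subtypeEquivRight ?_)) h1
  intro c
  rw [Polynomial.mem_rootSet]
  constructor
  · intro h
    exact ⟨hf0, by simpa [f] using h⟩
  · rintro ⟨-, h⟩
    simpa [f] using h

theorem galois_aux (p a q : ℕ) (hp : p.Prime) (ha : 0 < a) (hq : q = p ^ a)
    (K : Type) [Field K] [IsAlgClosed K] [CharP K p] (F : Type) [Field F] [Algebra K F]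
    (x y z : F) (htop : ∀ E : IntermediateField K F, x ∈ E → y ∈ E → z ∈ E → E = ⊤)
    (hxy : y ^ (q + 1) = x ^ q + x)
    (haut : ∀ c : K, c ^ q + c = 0 →
      ∃ σ : F ≃ₐ[K] F, σ x = x + algebraMap K F c ∧ σ y = y ∧ σ z = z) :
    IsGalois (IntermediateField.adjoin K ({y, z} : Set F)) F ∧
    Module.finrank (IntermediateField.adjoin K ({y, z} : Set F)) F = q ∧
    ∃ H : Subgroup (F ≃ₐ[K] F),
      (H : Set (F ≃ₐ[K] F)) = {σ | σ y = y ∧ σ z = z} ∧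
      Nat.card H = q ∧
      (∀ σ τ : H, σ * τ = τ * σ) ∧
      (∀ σ ∈ H, σ ^ p = 1) ∧
      ∀ σ : F ≃ₐ[K] F,
        σ ∈ H ↔ ∃ c : K, c ^ q ^ 2 = c ∧ c ^ q + c = 0 ∧
          σ x = x + algebraMap K F c ∧ σ y = y ∧ σ z = z := by
  have hq1 : 1 < q := by rw [hq]; exact Nat.one_lt_pow ha.ne' hp.one_lt
  have : Fact p.Prime := ⟨hp⟩
  have : CharP F p := charP_of_injective_algebraMap (algebraMap K F).injective p
  -- automorphisms are determined by x, y, z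
  have hext : ∀ σ τ : F ≃ₐ[K] F, σ x = τ x → σ y = τ y → σ z = τ z → σ = τ := by
    intro σ τ h1 h2 h3
    have := htop ((AlgHom.equalizer σ.toAlgHom τ.toAlgHom).toIntermediateField
      (fun w hw => by
        have hw' : σ w = τ w := hw
        change σ w⁻¹ = τ w⁻¹
        rw [map_inv₀, map_inv₀, hw'])) h1 h2 h3
    ext w
    have hw : w ∈ (⊤ : IntermediateField K F) := trivial
    rw [← this] at hw
    exact hw
  have hmem : ∀ σ : F ≃ₐ[K] F,
      σ ∈ (IntermediateField.adjoin K ({y, z} : Set F)).fixingSubgroup ↔ σ y = y ∧ σ z = z := by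
    intro σ
    constructor
    · intro h
      rw [IntermediateField.mem_fixingSubgroup_iff] at h
      exact ⟨h y (IntermediateField.subset_adjoin _ _ (by simp)),
        h z (IntermediateField.subset_adjoin _ _ (by simp))⟩
    · rintro ⟨h1, h2⟩
      have hle : IntermediateField.adjoin K ({y, z} : Set F) ≤
          (AlgHom.equalizer σ.toAlgHom (AlgHom.id K F)).toIntermediateField
          (fun w hw => by
            have hw' : σ w = w := hw
            change σ w⁻¹ = w⁻¹
            rw [map_inv₀, hw']) := by
        rw [IntermediateField.adjoin_le_iff]
        rintro w (rfl | rfl)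
        · exact h1
        · exact h2
      rw [IntermediateField.mem_fixingSubgroup_iff]
      intro w hw
      exact hle hw
  have hintK : ∀ d : F, d ^ q + d = 0 → ∃ c : K, algebraMap K F c = d := by
    intro d hd
    have hi : IsIntegral K d := by
      refine ⟨Polynomial.X ^ q + Polynomial.X, ?_, ?_⟩
      · exact Polynomial.monic_X_pow_add (by simpa using hq1)
      · simpa using hd
    exact minpoly.mem_range_of_degree_eq_one K d
      (IsAlgClosed.degree_eq_one_of_irreducible K (minpoly.irreducible hi))
  have hsq : ∀ c : K, c ^ q + c = 0 → c ^ q ^ 2 = c := by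
    intro c hc
    have h1 : c ^ q = -c := by linear_combination hc
    have h2 : (-c) ^ q = - c ^ q := by
      have : (c + -c) ^ q = c ^ q + (-c) ^ q := by rw [hq]; exact add_pow_char_pow ..
      rw [add_neg_cancel, zero_pow (by omega)] at this
      linear_combination -this
    rw [pow_two, pow_mul, h1, h2, h1, neg_neg]
  have hchar : ∀ σ : F ≃ₐ[K] F, (σ y = y ∧ σ z = z) ↔ ∃ c : K, c ^ q ^ 2 = c ∧ c ^ q + c = 0 ∧
          σ x = x + algebraMap K F c ∧ σ y = y ∧ σ z = z := by
    intro σ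
    constructor
    · rintro ⟨h1, h2⟩
      have h3 : y ^ (q + 1) = σ x ^ q + σ x := by
        have := congrArg σ hxy
        simpa [h1] using this
      have h4 : (σ x - x) ^ q = σ x ^ q - x ^ q := by
        rw [hq]; exact sub_pow_char_pow ..
      have h5 : (σ x - x) ^ q + (σ x - x) = 0 := by
        rw [h4]; linear_combination hxy - h3
      obtain ⟨c, hc⟩ := hintK _ h5
      have h6 : c ^ q + c = 0 := by
        apply (algebraMap K F).injective
        simpa [hc] using h5
      exact ⟨c, hsq c h6, h6, by rw [hc]; ring, h1, h2⟩
    · rintro ⟨c, -, -, -, h1, h2⟩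
      exact ⟨h1, h2⟩
  set H := (IntermediateField.adjoin K ({y, z} : Set F)).fixingSubgroup with hH
  have hcardH : Nat.card H = q := by
    choose τ hτ using haut
    rw [← card_kernel_aux p a q hp ha hq K]
    symm
    refine Nat.card_congr (Equiv.ofBijective
      (fun c => (⟨τ c.1 c.2, (hmem _).2 (hτ c.1 c.2).2⟩ : H)) ⟨?_, ?_⟩)
    · rintro ⟨c, hc⟩ ⟨d, hd⟩ h
      have h1 : τ c hc = τ d hd := congrArg Subtype.val h
      have h2 := (hτ c hc).1
      rw [h1, (hτ d hd).1] at h2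
      exact Subtype.ext ((algebraMap K F).injective (add_left_cancel h2)).symm
    · rintro ⟨σ, hσ⟩
      obtain ⟨c, -, hc, h1, h2, h3⟩ := (hchar σ).1 ((hmem σ).1 hσ)
      refine ⟨⟨c, hc⟩, Subtype.ext (hext _ _ ?_ ?_ ?_)⟩
      · exact (hτ c hc).1.trans h1.symm
      · exact (hτ c hc).2.1.trans h2.symm
      · exact (hτ c hc).2.2.trans h3.symm
  -- finiteness
  have key : FiniteDimensional (IntermediateField.adjoin K ({y, z} : Set F)) F ∧
      Module.finrank (IntermediateField.adjoin K ({y, z} : Set F)) F ≤ q := by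
    set E := IntermediateField.adjoin K ({y, z} : Set F) with hE
    have hy : y ∈ E := IntermediateField.subset_adjoin _ _ (by simp)
    have hz : z ∈ E := IntermediateField.subset_adjoin _ _ (by simp)
    let g : Polynomial E := Polynomial.X ^ q + (Polynomial.X - Polynomial.C ((⟨y, hy⟩ : E) ^ (q + 1)))
    have hdl : (Polynomial.X - Polynomial.C ((⟨y, hy⟩ : E) ^ (q + 1))).degree < (q : WithBot ℕ) := by
      rw [Polynomial.degree_X_sub_C]; exact_mod_cast hq1
    have hgm : g.Monic := Polynomial.monic_X_pow_add hdl
    have hgd : g.natDegree = q := by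
      apply Polynomial.natDegree_eq_of_degree_eq_some
      simp only [g]
      rw [Polynomial.degree_add_eq_left_of_degree_lt] <;> rw [Polynomial.degree_X_pow]
      exact hdl
    have hgx : Polynomial.aeval x g = 0 := by
      simp only [g, map_add, map_sub, map_pow, Polynomial.aeval_X, Polynomial.aeval_C]
      change x ^ q + (x - y ^ (q + 1)) = 0
      rw [hxy]; ring
    have hi : IsIntegral E x := ⟨g, hgm, hgx⟩
    have ht : IntermediateField.adjoin E {x} = ⊤ := by
      have := htop ((IntermediateField.adjoin E {x}).restrictScalars K)
        (IntermediateField.mem_adjoin_simple_self E x)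
        ((IntermediateField.adjoin E {x}).algebraMap_mem ⟨y, hy⟩)
        ((IntermediateField.adjoin E {x}).algebraMap_mem ⟨z, hz⟩)
      rw [eq_top_iff]
      intro w _
      have hw : w ∈ (⊤ : IntermediateField K F) := trivial
      rw [← this] at hw
      exact hw
    have h1 := IntermediateField.adjoin.finrank hi
    have h2 := IntermediateField.adjoin.finiteDimensional hi
    rw [ht] at h1 h2
    constructor
    · exact Module.Finite.equiv (IntermediateField.topEquiv (F := E) (E := F)).toLinearEquiv
    · rw [← IntermediateField.finrank_top' (F := E), h1, ← hgd]
      exact Polynomial.natDegree_le_of_dvd (minpoly.dvd E x hgx) hgm.ne_zero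
  obtain ⟨hfd, hle⟩ := key
  have hcardA : Nat.card (F ≃ₐ[IntermediateField.adjoin K ({y, z} : Set F)] F) = q := by
    rw [← hcardH]
    exact (Nat.card_congr (IntermediateField.fixingSubgroupEquiv _).toEquiv).symm
  have hge : q ≤ Module.finrank (IntermediateField.adjoin K ({y, z} : Set F)) F := by
    rw [← hcardA, Nat.card_eq_fintype_card]
    exact AlgEquiv.card_le
  have hfr := le_antisymm hle hge
  refine ⟨IsGalois.of_card_aut_eq_finrank _ _ (hcardA.trans hfr.symm), hfr, H, ?_, hcardH, ?_, ?_, ?_⟩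
  · ext σ; exact hmem σ
  · rintro ⟨σ, hσ⟩ ⟨τ, hτ⟩
    obtain ⟨c, -, hc, h1, h2, h3⟩ := (hchar σ).1 ((hmem σ).1 hσ)
    obtain ⟨d, -, hd, k1, k2, k3⟩ := (hchar τ).1 ((hmem τ).1 hτ)
    apply Subtype.ext
    apply hext <;> simp [h1, h2, h3, k1, k2, k3]
    ring
  · intro σ hσ
    obtain ⟨c, -, hc, h1, h2, h3⟩ := (hchar σ).1 ((hmem σ).1 hσ)
    have hpow : ∀ k : ℕ, (σ ^ k) x = x + k * algebraMap K F c ∧ (σ ^ k) y = y ∧ (σ ^ k) z = z := by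
      intro k
      induction k with
      | zero => simp
      | succ k ih =>
        obtain ⟨i1, i2, i3⟩ := ih
        rw [pow_succ', AlgEquiv.mul_apply, AlgEquiv.mul_apply, AlgEquiv.mul_apply, i1, i2, i3]
        refine ⟨?_, h2, h3⟩
        simp [h1]
        ring
    obtain ⟨i1, i2, i3⟩ := hpow p
    apply hext
    · simp [i1]
    · simp [i2]
    · simp [i3]
  · intro σ
    rw [hmem]; exact hchar σ

theorem YRing_rel (K : Type) [Field K] (q t : ℕ) :
    (Ideal.Quotient.mk (YIdeal K q t) (X 2)) ^ t =
      (Ideal.Quotient.mk (YIdeal K q t) (X 1)) ^ (q ^ 2) - Ideal.Quotient.mk (YIdeal K q t) (X 1) ∧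
    (Ideal.Quotient.mk (YIdeal K q t) (X 1)) ^ (q + 1) =
      (Ideal.Quotient.mk (YIdeal K q t) (X 0)) ^ q + Ideal.Quotient.mk (YIdeal K q t) (X 0) := by
  constructor
  · have : Ideal.Quotient.mk (YIdeal K q t) (X 2 ^ t - (X 1 ^ (q ^ 2) - X 1)) = 0 :=
      Ideal.Quotient.eq_zero_iff_mem.2 (Ideal.subset_span (by simp))
    simpa only [map_sub, map_pow, sub_eq_zero] using this
  · have : Ideal.Quotient.mk (YIdeal K q t) (X 1 ^ (q + 1) - (X 0 ^ q + X 0)) = 0 :=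
      Ideal.Quotient.eq_zero_iff_mem.2 (Ideal.subset_span (by simp))
    simpa only [map_sub, map_add, map_pow, sub_eq_zero] using this

theorem YRing_hom (p a q t : ℕ) (hp : p.Prime) (hq : q = p ^ a)
    (K : Type) [Field K] [CharP K p] (c : K) (hc : c ^ q + c = 0) :
    ∃ φ : YRing K q t →ₐ[K] YRing K q t,
      φ (Ideal.Quotient.mk _ (X 0)) = Ideal.Quotient.mk _ (X 0) + algebraMap K _ c ∧
      φ (Ideal.Quotient.mk _ (X 1)) = Ideal.Quotient.mk _ (X 1) ∧
      φ (Ideal.Quotient.mk _ (X 2)) = Ideal.Quotient.mk _ (X 2) := by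
  have : Fact p.Prime := ⟨hp⟩
  obtain ⟨r1, r2⟩ := YRing_rel K q t
  let ψ : MvPolynomial (Fin 3) K →ₐ[K] YRing K q t :=
    aeval ![Ideal.Quotient.mk _ (X 0) + algebraMap K _ c, Ideal.Quotient.mk _ (X 1),
      Ideal.Quotient.mk _ (X 2)]
  have hψ : ∀ w ∈ YIdeal K q t, ψ w = 0 := by
    have hle : YIdeal K q t ≤ RingHom.ker ψ := by
      have hfr : (Ideal.Quotient.mk (YIdeal K q t) (X 0) + algebraMap K _ c) ^ q =
          (Ideal.Quotient.mk (YIdeal K q t) (X 0)) ^ q + algebraMap K _ c ^ q := by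
        have : (X 0 + C c : MvPolynomial (Fin 3) K) ^ q = X 0 ^ q + C c ^ q := by
          rw [hq]; exact add_pow_char_pow ..
        have := congrArg (Ideal.Quotient.mk (YIdeal K q t)) this
        simp only [map_add, map_pow] at this
        exact this
      have hcc : (algebraMap K (YRing K q t) c) ^ q + algebraMap K _ c = 0 := by
        rw [← map_pow, ← map_add, hc, map_zero]
      refine Ideal.span_le.2 ?_
      rintro w (rfl | rfl)
      · simp [ψ, RingHom.mem_ker, r1]
      · simp only [SetLike.mem_coe, RingHom.mem_ker, ψ, map_sub, map_add, map_pow, aeval_X]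
        simp only [Matrix.cons_val_zero, Matrix.cons_val_one]
        rw [hfr, r2]
        linear_combination -hcc
    intro w hw
    exact hle hw
  refine ⟨Ideal.Quotient.liftₐ _ ψ hψ, ?_, ?_, ?_⟩ <;>
  · erw [Ideal.Quotient.liftₐ_apply, Ideal.Quotient.lift_mk]
    simp [ψ]

theorem YRing_hom_ext (K : Type) [Field K] (q t : ℕ) (φ : YRing K q t →ₐ[K] YRing K q t)
    (h : ∀ i, φ (Ideal.Quotient.mk _ (X i)) = Ideal.Quotient.mk _ (X i)) :
    φ = AlgHom.id K _ := by
  apply Ideal.Quotient.algHom_ext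
  apply MvPolynomial.algHom_ext
  intro i
  exact h i

theorem YField_aut (p a q t : ℕ) (hp : p.Prime) (ha : 0 < a) (hq : q = p ^ a)
    (K : Type) [Field K] [CharP K p] [hI : (YIdeal K q t).IsPrime] (c : K) (hc : c ^ q + c = 0) :
    ∃ σ : YField K q t ≃ₐ[K] YField K q t,
      σ (Yx K q t) = Yx K q t + algebraMap K _ c ∧
      σ (Yy K q t) = Yy K q t ∧ σ (Yz K q t) = Yz K q t := by
  have : Fact p.Prime := ⟨hp⟩
  have hc' : (-c) ^ q + (-c) = 0 := by
    have : (c + -c) ^ q = c ^ q + (-c) ^ q := by rw [hq]; exact add_pow_char_pow ..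
    rw [add_neg_cancel, zero_pow (by rw [hq]; exact pow_ne_zero _ hp.ne_zero)] at this
    linear_combination -this - hc
  obtain ⟨φ, f0, f1, f2⟩ := YRing_hom p a q t hp hq K c hc
  obtain ⟨ψ, g0, g1, g2⟩ := YRing_hom p a q t hp hq K (-c) hc'
  let e : YRing K q t ≃ₐ[K] YRing K q t := AlgEquiv.ofAlgHom φ ψ
    (by
      apply YRing_hom_ext
      intro i
      rw [AlgHom.comp_apply]
      fin_cases i
      · change φ (ψ (Ideal.Quotient.mk _ (X 0))) = Ideal.Quotient.mk _ (X 0)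
        rw [g0, map_add, f0, AlgHom.commutes, map_neg]; ring
      · change φ (ψ (Ideal.Quotient.mk _ (X 1))) = Ideal.Quotient.mk _ (X 1)
        rw [g1, f1]
      · change φ (ψ (Ideal.Quotient.mk _ (X 2))) = Ideal.Quotient.mk _ (X 2)
        rw [g2, f2])
    (by
      apply YRing_hom_ext
      intro i
      rw [AlgHom.comp_apply]
      fin_cases i
      · change ψ (φ (Ideal.Quotient.mk _ (X 0))) = Ideal.Quotient.mk _ (X 0)
        rw [f0, map_add, g0, AlgHom.commutes, map_neg]; ring
      · change ψ (φ (Ideal.Quotient.mk _ (X 1))) = Ideal.Quotient.mk _ (X 1)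
        rw [f1, g1]
      · change ψ (φ (Ideal.Quotient.mk _ (X 2))) = Ideal.Quotient.mk _ (X 2)
        rw [f2, g2])
  have he : ∀ w, e w = φ w := fun w => rfl
  refine ⟨IsFractionRing.algEquivOfAlgEquiv e, ?_, ?_, ?_⟩
  · rw [Yx, IsFractionRing.algEquivOfAlgEquiv_algebraMap, he, f0, map_add,
      ← IsScalarTower.algebraMap_apply]
  · rw [Yy, IsFractionRing.algEquivOfAlgEquiv_algebraMap, he, f1]
  · rw [Yz, IsFractionRing.algEquivOfAlgEquiv_algebraMap, he, f2]

theorem YField_top (K : Type) [Field K] (q t : ℕ) [hI : (YIdeal K q t).IsPrime]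
    (E : IntermediateField K (YField K q t)) (hx : Yx K q t ∈ E) (hy : Yy K q t ∈ E)
    (hz : Yz K q t ∈ E) : E = ⊤ := by
  have hR : ∀ w : YRing K q t, algebraMap (YRing K q t) (YField K q t) w ∈ E := by
    intro w
    obtain ⟨w, rfl⟩ := Ideal.Quotient.mk_surjective w
    induction w using MvPolynomial.induction_on with
    | C r =>
      have : algebraMap (YRing K q t) (YField K q t) (Ideal.Quotient.mk _ (C r)) =
        algebraMap K (YField K q t) r := by
        rw [IsScalarTower.algebraMap_apply K (YRing K q t) (YField K q t)]; rfl
      rw [this]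
      exact E.algebraMap_mem r
    | add u v hu hv => rw [map_add, map_add]; exact E.add_mem hu hv
    | mul_X u i hu =>
      rw [map_mul, map_mul]
      refine E.mul_mem hu ?_
      fin_cases i
      · exact hx
      · exact hy
      · exact hz
  rw [eq_top_iff]
  intro w _
  obtain ⟨u, v, -, rfl⟩ := IsFractionRing.div_surjective (A := YRing K q t) w
  exact E.div_mem (hR u) (hR v)

set_option synthInstance.maxHeartbeats 1000000 in
set_option maxHeartbeats 2000000 in
/-- Theorem: `F/K(y,z)` is Galois of degree `q`, and the subgroup
`{σ ∈ Aut(F/K) : σ y = y, σ z = z}` is elementary abelian of order `q` and consists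
precisely of the automorphisms `τ_c : (x,y,z) ↦ (x + c, y, z)` for `c ∈ 𝔽_{q^2}`
with `c^q + c = 0`. -/
theorem stmt6 (p a q n m s : ℕ) (hp : p.Prime) (ha : 0 < a) (hq : q = p ^ a)
    (hn : 3 ≤ n) (hodd : Odd n) (hm : m * (q + 1) = q ^ n + 1)
    (hs : s ∣ m) (hs0 : 0 < s) (hsm : s ≠ m)
    (K : Type) [Field K] [IsAlgClosed K] [CharP K p]
    [hI : (YIdeal K q (m / s)).IsPrime] :
    IsGalois (IntermediateField.adjoin K
        ({Yy K q (m / s), Yz K q (m / s)} : Set (YField K q (m / s))))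
        (YField K q (m / s)) ∧
    Module.finrank (IntermediateField.adjoin K
        ({Yy K q (m / s), Yz K q (m / s)} : Set (YField K q (m / s))))
        (YField K q (m / s)) = q ∧
    ∃ H : Subgroup (YField K q (m / s) ≃ₐ[K] YField K q (m / s)),
      (H : Set (YField K q (m / s) ≃ₐ[K] YField K q (m / s)))
          = {σ | σ (Yy K q (m / s)) = Yy K q (m / s) ∧ σ (Yz K q (m / s)) = Yz K q (m / s)} ∧
      Nat.card H = q ∧
      (∀ σ τ : H, σ * τ = τ * σ) ∧
      (∀ σ ∈ H, σ ^ p = 1) ∧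
      ∀ σ : YField K q (m / s) ≃ₐ[K] YField K q (m / s),
        σ ∈ H ↔ ∃ c : K, c ^ q ^ 2 = c ∧ c ^ q + c = 0 ∧
          σ (Yx K q (m / s)) = Yx K q (m / s) + algebraMap K (YField K q (m / s)) c ∧
          σ (Yy K q (m / s)) = Yy K q (m / s) ∧
          σ (Yz K q (m / s)) = Yz K q (m / s) := by
  refine galois_aux p a q hp ha hq K (YField K q (m / s)) _ _ _ (YField_top K q (m / s)) ?_
    (YField_aut p a q (m / s) hp ha hq K)
  have h := congrArg (algebraMap (YRing K q (m / s)) (YField K q (m / s)))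
    (YRing_rel K q (m / s)).2
  simp only [map_add, map_pow] at h
  exact h
end

section
/- The set D := {σ ∈ Aut(F/K) : there exist nonzero λ, μ, ρ ∈ K with σ(x) = λx, σ(y) = μy, σ(z) = ρz} is a cyclic subgroup of Aut(F/K) of order (q^2−1)·(m/s). Moreover, for σ ∈ D with σ(x) = λx, σ(y) = μy, σ(z) = ρz one necessarily has μ^{q^2} = μ, λ = μ^{q+1}, and ρ^{m/s} = μ. -/
open MvPolynomial

/-- Abstract form of the theorem, over any model `R` of the coordinate ring. -/
theorem core_aux (K R F : Type) [Field K] [IsAlgClosed K] [CommRing R] [IsDomain R] [Algebra K R]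
    [Field F] [Algebra R F] [Algebra K F] [IsScalarTower K R F] [IsFractionRing R F]
    (q t N : ℕ) (hq : 0 < q) (hN : N = (q ^ 2 - 1) * t) (hN0 : (N : K) ≠ 0)
    (x y z : R)
    (h1 : z ^ t = y ^ (q ^ 2) - y) (h2 : y ^ (q + 1) = x ^ q + x)
    (hy : ∀ A B : K, algebraMap K R A * y ^ (q ^ 2) = algebraMap K R B * y → A = 0 ∧ B = 0)
    (hx : ∀ A B : K, algebraMap K R A * x ^ q = algebraMap K R B * x → A = 0 ∧ B = 0)
    (hz : z ≠ 0)
    (hgen : ∀ f g : R →ₐ[K] F, f x = g x → f y = g y → f z = g z → f = g)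
    (hex : ∀ r : K, r ^ N = 1 → ∃ f : R →ₐ[K] R,
      f x = algebraMap K R ((r ^ t) ^ (q + 1)) * x ∧ f y = algebraMap K R (r ^ t) * y ∧
      f z = algebraMap K R r * z) :
    (∃ D : Subgroup (F ≃ₐ[K] F),
      (D : Set (F ≃ₐ[K] F)) = {σ | ∃ l u r : K, l ≠ 0 ∧ u ≠ 0 ∧ r ≠ 0 ∧
              σ (algebraMap R F x) = algebraMap K F l * algebraMap R F x ∧
              σ (algebraMap R F y) = algebraMap K F u * algebraMap R F y ∧
              σ (algebraMap R F z) = algebraMap K F r * algebraMap R F z} ∧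
      IsCyclic D ∧ Nat.card D = N) ∧
    ∀ σ : F ≃ₐ[K] F, ∀ l u r : K,
      l ≠ 0 → u ≠ 0 → r ≠ 0 →
      σ (algebraMap R F x) = algebraMap K F l * algebraMap R F x →
      σ (algebraMap R F y) = algebraMap K F u * algebraMap R F y →
      σ (algebraMap R F z) = algebraMap K F r * algebraMap R F z →
      u ^ q ^ 2 = u ∧ l = u ^ (q + 1) ∧ r ^ t = u := by
  have inj : Function.Injective (algebraMap R F) := IsFractionRing.injective R F
  have nec : ∀ σ : F ≃ₐ[K] F, ∀ l u r : K,
      σ (algebraMap R F x) = algebraMap K F l * algebraMap R F x →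
      σ (algebraMap R F y) = algebraMap K F u * algebraMap R F y →
      σ (algebraMap R F z) = algebraMap K F r * algebraMap R F z →
      u ^ q ^ 2 = u ∧ l = u ^ (q + 1) ∧ r ^ t = u := by
    intro σ l u r ex ey ez
    have e1 : algebraMap R F z ^ t = algebraMap R F y ^ (q ^ 2) - algebraMap R F y := by
      rw [← map_pow, h1]; simp
    have e2 : algebraMap R F y ^ (q + 1) = algebraMap R F x ^ q + algebraMap R F x := by
      rw [← map_pow, h2]; simp
    have e1' := congrArg σ e1
    have e2' := congrArg σ e2
    simp only [map_pow, map_sub, map_add, ex, ey, ez, mul_pow] at e1' e2'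
    rw [e1] at e1'
    rw [e2] at e2'
    obtain ⟨a1, a2⟩ := hy (r ^ t - u ^ (q ^ 2)) (r ^ t - u) (by
      apply inj
      simp only [map_mul, ← IsScalarTower.algebraMap_apply, map_sub, map_pow]
      linear_combination e1')
    obtain ⟨b1, b2⟩ := hx (u ^ (q + 1) - l ^ q) (l - u ^ (q + 1)) (by
      apply inj
      simp only [map_mul, ← IsScalarTower.algebraMap_apply, map_sub, map_pow]
      linear_combination e2')
    refine ⟨?_, ?_, ?_⟩
    · linear_combination a2 - a1
    · linear_combination b2
    · linear_combination a2
  refine ⟨?_, fun σ l u r _ _ _ => nec σ l u r⟩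
  have hgen' : ∀ f g : R →ₐ[K] R, f x = g x → f y = g y → f z = g z → f = g := by
    intro f g a b c
    have := hgen ((IsScalarTower.toAlgHom K R F).comp f) ((IsScalarTower.toAlgHom K R F).comp g)
      (by simp [a]) (by simp [b]) (by simp [c])
    ext w
    apply inj
    simpa using DFunLike.congr_fun this w
  choose f fx fy fz using hex
  have hroot : ∀ w : rootsOfUnity N K, ((w : Kˣ) : K) ^ N = 1 := fun w => by
    have := w.2
    rw [mem_rootsOfUnity'] at this
    exact this
  let φ : rootsOfUnity N K →* (R →ₐ[K] R) :=
    { toFun := fun w => f _ (hroot w)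
      map_one' := by
        apply hgen'
        · rw [fx]; simp
        · rw [fy]; simp
        · rw [fz]; simp
      map_mul' := by
        intro v w
        apply hgen'
        · rw [AlgHom.mul_apply, fx, fx, map_mul, AlgHom.commutes, fx]; simp [mul_pow]; ring
        · rw [AlgHom.mul_apply, fy, fy, map_mul, AlgHom.commutes, fy]; simp [mul_pow]; ring
        · rw [AlgHom.mul_apply, fz, fz, map_mul, AlgHom.commutes, fz]; simp; ring }
  let ψ : rootsOfUnity N K →* (F ≃ₐ[K] F) :=
    (IsFractionRing.fieldEquivOfAlgEquivHom K F).comp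
      ((AlgEquiv.algHomUnitsEquiv K R).toMonoidHom.comp φ.toHomUnits)
  have hψ : ∀ w b, ψ w (algebraMap R F b) = algebraMap R F (f _ (hroot w) b) := by
    intro w b
    change IsFractionRing.fieldEquivOfAlgEquiv K F F _ _ = _
    rw [IsFractionRing.fieldEquivOfAlgEquiv_algebraMap]
    rfl
  have hψx : ∀ w : rootsOfUnity N K, ψ w (algebraMap R F x) =
      algebraMap K F ((((w : Kˣ) : K) ^ t) ^ (q + 1)) * algebraMap R F x := by
    intro w; rw [hψ, fx, map_mul, ← IsScalarTower.algebraMap_apply]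
  have hψy : ∀ w : rootsOfUnity N K, ψ w (algebraMap R F y) =
      algebraMap K F (((w : Kˣ) : K) ^ t) * algebraMap R F y := by
    intro w; rw [hψ, fy, map_mul, ← IsScalarTower.algebraMap_apply]
  have hψz : ∀ w : rootsOfUnity N K, ψ w (algebraMap R F z) =
      algebraMap K F ((w : Kˣ) : K) * algebraMap R F z := by
    intro w; rw [hψ, fz, map_mul, ← IsScalarTower.algebraMap_apply]
  have hz' : algebraMap R F z ≠ 0 := by
    intro h; exact hz (inj (by simpa using h))
  have ψinj : Function.Injective ψ := by
    intro v w h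
    have := hψz v
    rw [h, hψz w] at this
    have := (algebraMap K F).injective (mul_right_cancel₀ hz' this)
    exact Subtype.ext (Units.ext this.symm)
  have : NeZero (N : K) := ⟨hN0⟩
  have : NeZero N := ⟨by rintro h; simp [h] at hN0⟩
  refine ⟨ψ.range, ?_, ?_, ?_⟩
  · ext σ
    constructor
    · rintro ⟨w, rfl⟩
      exact ⟨_, _, _, by simp, by simp, by simp, hψx w, hψy w, hψz w⟩
    · rintro ⟨l, u, r, hl, hu, hr, ex, ey, ez⟩
      obtain ⟨n1, n2, n3⟩ := nec σ l u r ex ey ez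
      have hu1 : u ^ (q ^ 2 - 1) = 1 := by
        apply mul_right_cancel₀ hu
        rw [← pow_succ, Nat.sub_add_cancel (Nat.pow_pos hq), n1, one_mul]
      have hrN : r ^ N = 1 := by
        rw [hN, mul_comm, pow_mul, n3, hu1]
      let w : rootsOfUnity N K := ⟨Units.mk0 r hr, by rw [mem_rootsOfUnity']; simpa using hrN⟩
      refine ⟨w, ?_⟩
      have key := hgen ((ψ w).toAlgHom.comp (IsScalarTower.toAlgHom K R F))
        (σ.toAlgHom.comp (IsScalarTower.toAlgHom K R F))
        (by
          have := hψx w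
          change ψ w (algebraMap R F x) = σ (algebraMap R F x)
          rw [this, ex, n2, ← n3]; rfl)
        (by
          have := hψy w
          change ψ w (algebraMap R F y) = σ (algebraMap R F y)
          rw [this, ey, ← n3]; rfl)
        (by
          have := hψz w
          change ψ w (algebraMap R F z) = σ (algebraMap R F z)
          rw [this, ez]; rfl)
      have key2 : ∀ b : R, ψ w (algebraMap R F b) = σ (algebraMap R F b) :=
        fun b => DFunLike.congr_fun key b
      ext c
      obtain ⟨a, b, -, rfl⟩ := IsFractionRing.div_surjective R c
      rw [map_div₀, map_div₀, key2, key2]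
  · exact isCyclic_of_surjective ψ.rangeRestrict ψ.rangeRestrict_surjective
  · rw [← Nat.card_congr (MonoidHom.ofInjective ψinj).toEquiv]
    exact HasEnoughRootsOfUnity.natCard_rootsOfUnity K N

theorem YIdeal_eval {K : Type} [Field K] {q t : ℕ} (c : Fin 3 → K)
    (h1 : c 2 ^ t = c 1 ^ (q ^ 2) - c 1) (h2 : c 1 ^ (q + 1) = c 0 ^ q + c 0)
    (P : MvPolynomial (Fin 3) K) (hP : P ∈ YIdeal K q t) : aeval c P = 0 := by
  have : YIdeal K q t ≤ RingHom.ker (aeval c : MvPolynomial (Fin 3) K →ₐ[K] K) := by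
    rw [YIdeal, Ideal.span_le]
    rintro _ (rfl | rfl)
    · simp [RingHom.mem_ker, h1]
    · simp [RingHom.mem_ker, h2]
  exact this hP

theorem coeff_aux {K : Type} [Field K] [IsAlgClosed K] (A B : K) (k : ℕ) (hk : 2 ≤ k)
    (h : ∀ c : K, A * c ^ k = B * c) : A = 0 ∧ B = 0 := by
  have hAB : A = B := by simpa using h 1
  subst hAB
  have hd : (Polynomial.X ^ k - Polynomial.X - 1 : Polynomial K).degree ≠ 0 := by
    have : (Polynomial.X ^ k - Polynomial.X - 1 : Polynomial K).degree = k := by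
      rw [sub_sub]
      rw [Polynomial.degree_sub_eq_left_of_degree_lt]
      · simp
      · rw [Polynomial.degree_X_pow]
        have : (Polynomial.X + 1 : Polynomial K) = Polynomial.X + Polynomial.C 1 := by simp
        rw [this, Polynomial.degree_X_add_C]
        exact_mod_cast hk
    rw [this]
    exact_mod_cast (by omega : k ≠ 0)
  obtain ⟨c, hc⟩ := IsAlgClosed.exists_root _ hd
  simp [Polynomial.IsRoot] at hc
  have hc' := h c
  have : A = 0 := by linear_combination hc' - A * hc
  exact ⟨this, this⟩

theorem exists_pt_y {K : Type} [Field K] [IsAlgClosed K] {q t : ℕ} (hq : 2 ≤ q) (ht : 0 < t)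
    (c : K) : ∃ v : Fin 3 → K, v 1 = c ∧ v 2 ^ t = v 1 ^ (q ^ 2) - v 1 ∧
      v 1 ^ (q + 1) = v 0 ^ q + v 0 := by
  obtain ⟨z, hz⟩ := IsAlgClosed.exists_pow_nat_eq (c ^ (q ^ 2) - c) ht
  have hd : (Polynomial.X ^ q + (Polynomial.X - Polynomial.C (c ^ (q + 1))) :
      Polynomial K).degree ≠ 0 := by
    rw [Polynomial.degree_add_eq_left_of_degree_lt]
    · rw [Polynomial.degree_X_pow]; exact_mod_cast (by omega : q ≠ 0)
    · rw [Polynomial.degree_X_pow, Polynomial.degree_X_sub_C]; exact_mod_cast hq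
  obtain ⟨x, hx⟩ := IsAlgClosed.exists_root _ hd
  simp only [Polynomial.IsRoot, Polynomial.eval_add, Polynomial.eval_sub, Polynomial.eval_pow,
    Polynomial.eval_X, Polynomial.eval_C] at hx
  refine ⟨![x, c, z], rfl, hz, ?_⟩
  simp only [Matrix.cons_val]
  linear_combination -hx

theorem exists_pt_x {K : Type} [Field K] [IsAlgClosed K] {q t : ℕ} (ht : 0 < t)
    (c : K) : ∃ v : Fin 3 → K, v 0 = c ∧ v 2 ^ t = v 1 ^ (q ^ 2) - v 1 ∧
      v 1 ^ (q + 1) = v 0 ^ q + v 0 := by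
  obtain ⟨y, hy⟩ := IsAlgClosed.exists_pow_nat_eq (c ^ q + c) (Nat.succ_pos q)
  obtain ⟨z, hz⟩ := IsAlgClosed.exists_pow_nat_eq (y ^ (q ^ 2) - y) ht
  exact ⟨![c, y, z], rfl, hz, hy⟩

set_option synthInstance.maxHeartbeats 1000000 in
set_option maxHeartbeats 2000000 in
/-- Theorem: the set `D = {σ ∈ Aut(F/K) : σ x = λx, σ y = μy, σ z = ρz for some nonzero
λ, μ, ρ ∈ K}` is a cyclic subgroup of `Aut(F/K)` of order `(q^2-1)(m/s)`; moreover for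
such a `σ` one necessarily has `μ^{q^2} = μ`, `λ = μ^{q+1}` and `ρ^{m/s} = μ`. -/
theorem stmt7 (p a q n m s : ℕ) (hp : p.Prime) (ha : 0 < a) (hq : q = p ^ a)
    (hn : 3 ≤ n) (hodd : Odd n) (hm : m * (q + 1) = q ^ n + 1)
    (hs : s ∣ m) (hs0 : 0 < s) (hsm : s ≠ m)
    (K : Type) [Field K] [IsAlgClosed K] [CharP K p]
    [hI : (YIdeal K q (m / s)).IsPrime] :
    (∃ D : Subgroup (YField K q (m / s) ≃ₐ[K] YField K q (m / s)),
      (D : Set (YField K q (m / s) ≃ₐ[K] YField K q (m / s)))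
          = {σ | ∃ l u r : K, l ≠ 0 ∧ u ≠ 0 ∧ r ≠ 0 ∧
              σ (Yx K q (m / s)) = algebraMap K (YField K q (m / s)) l * Yx K q (m / s) ∧
              σ (Yy K q (m / s)) = algebraMap K (YField K q (m / s)) u * Yy K q (m / s) ∧
              σ (Yz K q (m / s)) = algebraMap K (YField K q (m / s)) r * Yz K q (m / s)} ∧
      IsCyclic D ∧ Nat.card D = (q ^ 2 - 1) * (m / s)) ∧
    ∀ σ : YField K q (m / s) ≃ₐ[K] YField K q (m / s), ∀ l u r : K,
      l ≠ 0 → u ≠ 0 → r ≠ 0 →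
      σ (Yx K q (m / s)) = algebraMap K (YField K q (m / s)) l * Yx K q (m / s) →
      σ (Yy K q (m / s)) = algebraMap K (YField K q (m / s)) u * Yy K q (m / s) →
      σ (Yz K q (m / s)) = algebraMap K (YField K q (m / s)) r * Yz K q (m / s) →
      u ^ q ^ 2 = u ∧ l = u ^ (q + 1) ∧ r ^ (m / s) = u := by
  have hp2 := hp.two_le
  have hq2 : 2 ≤ q := by
    rw [hq]; exact hp2.trans (Nat.le_self_pow ha.ne' p)
  have hm0 : m ≠ 0 := by rintro rfl; simp at hm
  have ht : 0 < m / s := Nat.div_pos (Nat.le_of_dvd (Nat.pos_of_ne_zero hm0) hs) hs0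
  have hpq : p ∣ q := by rw [hq]; exact dvd_pow_self p ha.ne'
  have hqK : (q : K) = 0 := (CharP.cast_eq_zero_iff K p q).2 hpq
  have htK : ((m / s : ℕ) : K) ≠ 0 := by
    intro h
    have hmK : (m : K) = 0 := by
      rw [← Nat.div_mul_cancel hs, Nat.cast_mul, h, zero_mul]
    have := congrArg (Nat.cast : ℕ → K) hm
    push_cast at this
    rw [hmK, hqK, zero_pow (by omega)] at this
    simp at this
  generalize m / s = t at *
  have hN0 : (((q ^ 2 - 1) * t : ℕ) : K) ≠ 0 := by
    rw [Nat.cast_mul, Nat.cast_sub (Nat.pow_pos (by omega))]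
    simp [hqK, htK]
  have r1 : (Ideal.Quotient.mk (YIdeal K q t) (X 2)) ^ t =
      Ideal.Quotient.mk (YIdeal K q t) (X 1) ^ (q ^ 2) - Ideal.Quotient.mk (YIdeal K q t) (X 1) := by
    rw [← map_pow, ← map_pow, ← map_sub, Ideal.Quotient.eq]
    exact Ideal.subset_span (by simp)
  have r2 : (Ideal.Quotient.mk (YIdeal K q t) (X 1)) ^ (q + 1) =
      Ideal.Quotient.mk (YIdeal K q t) (X 0) ^ q + Ideal.Quotient.mk (YIdeal K q t) (X 0) := by
    rw [← map_pow, ← map_pow, ← map_add, Ideal.Quotient.eq]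
    exact Ideal.subset_span (by simp)
  have amap : ∀ A : K, algebraMap K (YRing K q t) A = Ideal.Quotient.mk (YIdeal K q t) (C A) :=
    fun A => rfl
  refine core_aux K (YRing K q t) (YField K q t) q t ((q ^ 2 - 1) * t) (by omega) rfl hN0
    (Ideal.Quotient.mk _ (X 0)) (Ideal.Quotient.mk _ (X 1)) (Ideal.Quotient.mk _ (X 2))
    r1 r2 ?_ ?_ ?_ ?_ ?_
  · intro A B h
    rw [amap, amap, ← map_pow, ← map_mul, ← map_mul, Ideal.Quotient.eq] at h
    refine coeff_aux A B (q ^ 2) (by nlinarith) fun c => ?_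
    obtain ⟨v, v1, v2, v3⟩ := exists_pt_y (t := t) hq2 ht c
    have := YIdeal_eval v v2 v3 _ h
    simp [v1] at this
    linear_combination this
  · intro A B h
    rw [amap, amap, ← map_pow, ← map_mul, ← map_mul, Ideal.Quotient.eq] at h
    refine coeff_aux A B q hq2 fun c => ?_
    obtain ⟨v, v1, v2, v3⟩ := exists_pt_x (q := q) ht c
    have := YIdeal_eval v v2 v3 _ h
    simp [v1] at this
    linear_combination this
  · intro h
    rw [Ideal.Quotient.eq_zero_iff_mem] at h
    have := coeff_aux (1 : K) 1 (q ^ 2) (by nlinarith) fun c => by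
      obtain ⟨v, v1, v2, v3⟩ := exists_pt_y (t := t) hq2 ht c
      have := YIdeal_eval v v2 v3 _ h
      simp only [aeval_X] at this
      rw [this, zero_pow ht.ne', v1] at v2
      linear_combination -v2
    simp at this
  · intro f g e0 e1 e2
    apply Ideal.Quotient.algHom_ext
    apply MvPolynomial.algHom_ext
    intro i
    fin_cases i
    · exact e0
    · exact e1
    · exact e2
  · intro r hr
    have hu : (r ^ t) ^ (q ^ 2) = r ^ t := by
      have : (r ^ t) ^ (q ^ 2 - 1) = 1 := by rw [← pow_mul, mul_comm]; exact hr
      rw [← Nat.sub_add_cancel (Nat.pow_pos (by omega) : 1 ≤ q ^ 2), pow_succ, this, one_mul]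
    have hl : ((r ^ t) ^ (q + 1)) ^ q = (r ^ t) ^ (q + 1) := by
      rw [← pow_mul, show (q + 1) * q = q ^ 2 + q by ring, pow_add, hu, pow_succ, mul_comm]
    let g : MvPolynomial (Fin 3) K →ₐ[K] YRing K q t := aeval
      ![algebraMap K (YRing K q t) ((r ^ t) ^ (q + 1)) * Ideal.Quotient.mk _ (X 0),
        algebraMap K (YRing K q t) (r ^ t) * Ideal.Quotient.mk _ (X 1),
        algebraMap K (YRing K q t) r * Ideal.Quotient.mk _ (X 2)]
    have g0 : g (X 0) = algebraMap K (YRing K q t) ((r ^ t) ^ (q + 1)) *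
      Ideal.Quotient.mk _ (X 0) := aeval_X _ _
    have g1 : g (X 1) = algebraMap K (YRing K q t) (r ^ t) * Ideal.Quotient.mk _ (X 1) :=
      aeval_X _ _
    have g2 : g (X 2) = algebraMap K (YRing K q t) r * Ideal.Quotient.mk _ (X 2) :=
      aeval_X _ _
    have hg : YIdeal K q t ≤ RingHom.ker g := by
      refine Ideal.span_le.2 ?_
      rintro _ (rfl | rfl)
      · rw [SetLike.mem_coe, RingHom.mem_ker, map_sub, map_sub, map_pow, map_pow, g1, g2,
          mul_pow, mul_pow, ← map_pow (algebraMap K (YRing K q t)), ← map_pow (algebraMap K (YRing K q t)), hu, r1]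
        ring
      · rw [SetLike.mem_coe, RingHom.mem_ker, map_sub, map_add, map_pow, map_pow, g0, g1,
          mul_pow, mul_pow, ← map_pow (algebraMap K (YRing K q t)),
          ← map_pow (algebraMap K (YRing K q t)), hl, r2]
        ring
    refine ⟨Ideal.Quotient.liftₐ (YIdeal K q t) g fun a ha => hg ha, g0, g1, g2⟩
end

section
/- For each λ ∈ K with λ^{q̄} = λ there exists exactly one automorphism σ_λ ∈ Aut(F/K) with σ_λ(u) = u + λ/c, σ_λ(v) = v, σ_λ(w) = w; the set E := {σ_λ : λ^{q̄} = λ} is an elementary abelian subgroup of Aut(F/K) of order q̄; and the fixed field F^E equals the subfield K(x, v, w) of F, where x := c·u − (c·u)^{q̄}. (In other words, the curve X_{a,b,n,s} is the quotient of Y_{n,s} by E_{q̄}.) -/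
open MvPolynomial

/-- The coordinate function `u ∈ F`, image of the variable `U`. -/
noncomputable def Yu (K : Type) [Field K] (q t : ℕ) : YField K q t :=
  algebraMap (YRing K q t) (YField K q t) (Ideal.Quotient.mk _ (X 0))

/-- The coordinate function `v ∈ F`, image of the variable `V`. -/
noncomputable def Yv (K : Type) [Field K] (q t : ℕ) : YField K q t :=
  algebraMap (YRing K q t) (YField K q t) (Ideal.Quotient.mk _ (X 1))

/-- The coordinate function `w ∈ F`, image of the variable `W`. -/
noncomputable def Yw (K : Type) [Field K] (q t : ℕ) : YField K q t :=
  algebraMap (YRing K q t) (YField K q t) (Ideal.Quotient.mk _ (X 2))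

/-- Two automorphisms agreeing on field generators are equal. -/
theorem core_ext {K F : Type} [Field K] [Field F] [Algebra K F] (u v w : F)
    (htop : IntermediateField.adjoin K ({u, v, w} : Set F) = ⊤)
    (σ τ : F ≃ₐ[K] F) (hu : σ u = τ u) (hv : σ v = τ v) (hw : σ w = τ w) : σ = τ := by
  apply AlgEquiv.ext
  intro z
  have hz : z ∈ IntermediateField.adjoin K ({u, v, w} : Set F) := by
    rw [htop]; trivial
  induction hz using IntermediateField.adjoin_induction with
  | mem x hx =>
    rcases hx with rfl | rfl | rfl <;> assumption
  | algebraMap x => simp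
  | add x y _ _ hx hy => simp [hx, hy]
  | inv x _ hx => simp [hx]
  | mul x y _ _ hx hy => simp [hx, hy]

/-- There are exactly `p ^ b` solutions of `l ^ (p ^ b) = l`. -/
theorem card_fixed {K : Type} [Field K] [IsAlgClosed K] (p b : ℕ) (hp : p.Prime) (hb : 0 < b)
    [CharP K p] : Nat.card {l : K // l ^ p ^ b = l} = p ^ b := by
  have h1 := Polynomial.card_rootSet_eq_natDegree (K := K)
    (galois_poly_separable (K := K) p (p ^ b) (dvd_pow_self p hb.ne'))
    (IsAlgClosed.splits _)
  have h2 := FiniteField.X_pow_card_pow_sub_X_natDegree_eq K hb.ne' hp.one_lt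
  rw [h2, ← Nat.card_eq_fintype_card] at h1
  refine Eq.trans ?_ h1
  refine Nat.card_congr (Equiv.subtypeEquivRight fun l => ?_)
  rw [Polynomial.mem_rootSet_of_ne
    (FiniteField.X_pow_card_pow_sub_X_ne_zero K hb.ne' hp.one_lt)]
  simp [sub_eq_zero]

/-- The degree of `F` over `K(x, v, w)` is at most `r`. -/
theorem core_degree {K F : Type} [Field K] [Field F] [Algebra K F] (r : ℕ) (hr : 1 < r)
    (c : K) (hc : c ≠ 0) (u v w : F)
    (htop : IntermediateField.adjoin K ({u, v, w} : Set F) = ⊤)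
    (L : IntermediateField K F)
    (hL : L = IntermediateField.adjoin K
            ({algebraMap K F c * u - (algebraMap K F c * u) ^ r, v, w} : Set F)) :
    FiniteDimensional L F ∧ Module.finrank L F ≤ r := by
  have hx : algebraMap K F c * u - (algebraMap K F c * u) ^ r ∈ L := by
    rw [hL]; exact IntermediateField.subset_adjoin _ _ (by simp)
  have hv : v ∈ L := by
    rw [hL]; exact IntermediateField.subset_adjoin _ _ (by simp)
  have hw : w ∈ L := by
    rw [hL]; exact IntermediateField.subset_adjoin _ _ (by simp)
  have hcF : algebraMap K F c ≠ 0 := by simpa using hc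
  set y := algebraMap K F c * u with hy
  let P : Polynomial L := Polynomial.X ^ r +
    (-Polynomial.X + Polynomial.C (⟨y - y ^ r, hx⟩ : L))
  have hdeg : (-Polynomial.X + Polynomial.C (⟨y - y ^ r, hx⟩ : L) : Polynomial L).degree
      < (r : WithBot ℕ) := by
    refine lt_of_le_of_lt (b := 1) ?_ (by exact_mod_cast hr)
    compute_degree
  have hmonic : P.Monic := Polynomial.monic_X_pow_add hdeg
  have hnat : P.natDegree = r := by
    have h1 : P.degree = (r : WithBot ℕ) := by
      change (Polynomial.X ^ r + _ : Polynomial L).degree = _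
      rw [Polynomial.degree_add_eq_left_of_degree_lt] <;> rw [Polynomial.degree_X_pow]
      exact hdeg
    exact Polynomial.natDegree_eq_of_degree_eq_some h1
  have hroot : Polynomial.aeval y P = 0 := by
    simp only [P, map_add, map_pow, map_neg, Polynomial.aeval_X, Polynomial.aeval_C]
    change y ^ r + (-y + (y - y ^ r)) = 0
    ring
  have hint : IsIntegral L y := ⟨P, hmonic, hroot⟩
  have hadj : IntermediateField.adjoin L ({y} : Set F) = ⊤ := by
    have hle : (⊤ : IntermediateField K F) ≤
        (IntermediateField.adjoin L ({y} : Set F)).restrictScalars K := by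
      rw [← htop, IntermediateField.adjoin_le_iff]
      have hLm : ∀ z ∈ L, z ∈ IntermediateField.adjoin L ({y} : Set F) := fun z hz =>
        (IntermediateField.adjoin L ({y} : Set F)).algebraMap_mem ⟨z, hz⟩
      have hym : y ∈ IntermediateField.adjoin L ({y} : Set F) :=
        IntermediateField.mem_adjoin_simple_self L y
      rintro z (rfl | rfl | rfl)
      · have h2 := mul_mem (hLm _ (L.algebraMap_mem c⁻¹)) hym
        have h3 : algebraMap K F c⁻¹ * y = z := by
          rw [hy, map_inv₀, inv_mul_cancel_left₀ hcF]
        rw [h3] at h2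
        exact h2
      · exact hLm _ hv
      · exact hLm _ hw
    rw [eq_top_iff]
    intro z _
    exact hle (show z ∈ (⊤ : IntermediateField K F) from trivial)
  have hfd : FiniteDimensional L (IntermediateField.adjoin L ({y} : Set F)) :=
    IntermediateField.adjoin.finiteDimensional hint
  have hfr := IntermediateField.adjoin.finrank hint
  rw [hadj] at hfd hfr
  have e := (IntermediateField.topEquiv (F := L) (E := F)).toLinearEquiv
  refine ⟨Module.Finite.equiv e, ?_⟩
  rw [← e.finrank_eq, hfr, ← hnat]
  exact Polynomial.natDegree_le_of_dvd (minpoly.dvd _ _ hroot) hmonic.ne_zero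

theorem core {K F : Type} [Field K] [IsAlgClosed K] [Field F] [Algebra K F]
    (p b qb : ℕ) (hp : p.Prime) (hb : 0 < b) (hqb : qb = p ^ b) [CharP K p]
    (c : K) (hc : c ≠ 0) (u v w : F)
    (htop : IntermediateField.adjoin K ({u, v, w} : Set F) = ⊤)
    (hex : ∀ l : K, l ^ qb = l → ∃ σ : F ≃ₐ[K] F,
      σ u = u + algebraMap K F (l / c) ∧ σ v = v ∧ σ w = w) :
    (∀ l : K, l ^ qb = l →
      ∃! σ : F ≃ₐ[K] F,
        σ u = u + algebraMap K F (l / c) ∧ σ v = v ∧ σ w = w) ∧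
    ∃ E : Subgroup (F ≃ₐ[K] F),
      (E : Set (F ≃ₐ[K] F))
          = {σ | ∃ l : K, l ^ qb = l ∧
              σ u = u + algebraMap K F (l / c) ∧ σ v = v ∧ σ w = w} ∧
      (∀ σ τ : E, σ * τ = τ * σ) ∧
      (∀ σ ∈ E, σ ^ p = 1) ∧
      Nat.card E = qb ∧
      IntermediateField.fixedField E
        = IntermediateField.adjoin K
            ({algebraMap K F c * u - (algebraMap K F c * u) ^ qb, v, w} : Set F) := by
  have hext := core_ext u v w htop
  have : Fact p.Prime := ⟨hp⟩
  have : CharP F p := charP_of_injective_algebraMap (algebraMap K F).injective p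
  have hadd : ∀ x y : K, x ^ qb = x → y ^ qb = y → (x + y) ^ qb = x + y := by
    intro x y hx hy
    subst hqb
    rw [add_pow_char_pow, hx, hy]
  have hqb1 : 1 < qb := by rw [hqb]; exact Nat.one_lt_pow hb.ne' hp.one_lt
  have hneg : ∀ x : K, x ^ qb = x → (-x) ^ qb = -x := by
    intro x hx
    have h0 : (x + -x) ^ qb = x ^ qb + (-x) ^ qb := by
      subst hqb; rw [add_pow_char_pow]
    rw [hx, add_neg_cancel, zero_pow (by omega)] at h0
    exact (neg_eq_of_add_eq_zero_right h0.symm).symm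
  let E : Subgroup (F ≃ₐ[K] F) :=
    { carrier := {σ | ∃ l : K, l ^ qb = l ∧
              σ u = u + algebraMap K F (l / c) ∧ σ v = v ∧ σ w = w}
      one_mem' := ⟨0, zero_pow (by omega), by simp, rfl, rfl⟩
      mul_mem' := by
        rintro σ τ ⟨l, hl, h1, h2, h3⟩ ⟨k, hk, g1, g2, g3⟩
        refine ⟨l + k, hadd _ _ hl hk, ?_, ?_, ?_⟩
        · rw [AlgEquiv.mul_apply, g1, map_add, h1, AlgEquiv.commutes, add_div, map_add, add_assoc]
        · rw [AlgEquiv.mul_apply, g2, h2]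
        · rw [AlgEquiv.mul_apply, g3, h3]
      inv_mem' := by
        rintro σ ⟨l, hl, h1, h2, h3⟩
        refine ⟨-l, hneg l hl, ?_, ?_, ?_⟩
        · apply σ.injective
          rw [← AlgEquiv.mul_apply, mul_inv_cancel, AlgEquiv.one_apply, map_add, h1,
            AlgEquiv.commutes, neg_div, map_neg]
          ring
        · apply σ.injective
          rw [← AlgEquiv.mul_apply, mul_inv_cancel, AlgEquiv.one_apply, h2]
        · apply σ.injective
          rw [← AlgEquiv.mul_apply, mul_inv_cancel, AlgEquiv.one_apply, h3] }
  have hmem : ∀ σ : F ≃ₐ[K] F, σ ∈ E ↔ ∃ l : K, l ^ qb = l ∧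
              σ u = u + algebraMap K F (l / c) ∧ σ v = v ∧ σ w = w := fun σ => Iff.rfl
  have hcard : Nat.card E = qb := by
    rw [hqb, ← card_fixed (K := K) p b hp hb, ← hqb]
    choose f hf using hex
    symm
    refine Nat.card_congr (Equiv.ofBijective
      (fun l : {l : K // l ^ qb = l} => (⟨f l.1 l.2, l.1, l.2, hf l.1 l.2⟩ : E)) ⟨?_, ?_⟩)
    · rintro ⟨l, hl⟩ ⟨k, hk⟩ h
      have h1 : f l hl = f k hk := congrArg Subtype.val h
      have h2 := (hf l hl).1
      rw [h1, (hf k hk).1] at h2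
      have h3 := (algebraMap K F).injective (add_left_cancel h2)
      have h4 : k = l := by
        field_simp at h3
        exact h3
      exact Subtype.ext h4.symm
    · rintro ⟨σ, l, hl, h1, h2, h3⟩
      refine ⟨⟨l, hl⟩, Subtype.ext ?_⟩
      have := hf l hl
      exact hext _ _ (this.1.trans h1.symm) (this.2.1.trans h2.symm) (this.2.2.trans h3.symm)
  refine ⟨?_, E, rfl, ?_, ?_, hcard, ?_⟩
  · intro l hl
    obtain ⟨σ, h1, h2, h3⟩ := hex l hl
    refine ⟨σ, ⟨h1, h2, h3⟩, ?_⟩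
    rintro τ ⟨g1, g2, g3⟩
    exact hext _ _ (g1.trans h1.symm) (g2.trans h2.symm) (g3.trans h3.symm)
  · rintro ⟨σ, l, hl, h1, h2, h3⟩ ⟨τ, k, hk, g1, g2, g3⟩
    apply Subtype.ext
    change σ * τ = τ * σ
    apply hext
    · simp only [AlgEquiv.mul_apply, g1, h1, map_add, AlgEquiv.commutes]
      ring
    · simp only [AlgEquiv.mul_apply, g2, h2]
    · simp only [AlgEquiv.mul_apply, g3, h3]
  · rintro σ ⟨l, hl, h1, h2, h3⟩
    have key : ∀ k : ℕ, (σ ^ k) u = u + (k : F) * algebraMap K F (l / c) ∧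
        (σ ^ k) v = v ∧ (σ ^ k) w = w := by
      intro k
      induction k with
      | zero => simp
      | succ k ih =>
        obtain ⟨i1, i2, i3⟩ := ih
        refine ⟨?_, ?_, ?_⟩
        · rw [pow_succ, AlgEquiv.mul_apply, h1, map_add, i1, AlgEquiv.commutes]
          push_cast
          ring
        · rw [pow_succ, AlgEquiv.mul_apply, h2, i2]
        · rw [pow_succ, AlgEquiv.mul_apply, h3, i3]
    obtain ⟨i1, i2, i3⟩ := key p
    apply hext
    · rw [i1, CharP.cast_eq_zero F p]; simp
    · rw [i2]; rfl
    · rw [i3]; rfl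
  · obtain ⟨hfd, hle⟩ := core_degree qb hqb1 c hc u v w htop _ rfl
    symm
    refine IntermediateField.eq_of_le_of_finrank_le' ?_ ?_
    · rw [IntermediateField.adjoin_le_iff]
      intro z hz
      rw [SetLike.mem_coe, IntermediateField.mem_fixedField_iff]
      rintro σ ⟨l, hl, h1, h2, h3⟩
      rcases hz with rfl | rfl | rfl
      · have h4 : σ (algebraMap K F c * u) = algebraMap K F c * u + algebraMap K F l := by
          rw [map_mul, h1, AlgEquiv.commutes, mul_add, ← map_mul, mul_div_cancel₀ _ hc]
        rw [map_sub, map_pow, h4]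
        have h5 : (algebraMap K F c * u + algebraMap K F l) ^ qb
            = (algebraMap K F c * u) ^ qb + algebraMap K F l := by
          conv_rhs => rw [← hl, map_pow]
          rw [hqb, add_pow_char_pow]
        rw [h5]
        ring
      · exact h2
      · exact h3
    · refine hle.trans ?_
      have : Finite E := Nat.finite_of_card_ne_zero (by omega)
      have := Fintype.ofFinite E
      have h6 := FixedPoints.finrank_eq_card E F
      rw [← Nat.card_eq_fintype_card, hcard] at h6
      exact h6.symm.le

/-- The relations defining the curve, in the coordinate ring. -/
theorem Yring_rel (K : Type) [Field K] (q t : ℕ) :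
    (Ideal.Quotient.mk (YIdeal K q t) (X 2) ^ t
      - (Ideal.Quotient.mk (YIdeal K q t) (X 1) ^ (q ^ 2)
        - Ideal.Quotient.mk (YIdeal K q t) (X 1)) = 0) ∧
    (Ideal.Quotient.mk (YIdeal K q t) (X 1) ^ (q + 1)
      - (Ideal.Quotient.mk (YIdeal K q t) (X 0) ^ q
        + Ideal.Quotient.mk (YIdeal K q t) (X 0)) = 0) := by
  constructor
  · have h : (X 2 ^ t - (X 1 ^ (q ^ 2) - X 1) : MvPolynomial (Fin 3) K) ∈ YIdeal K q t :=
      Ideal.subset_span (by simp)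
    simpa using Ideal.Quotient.eq_zero_iff_mem.mpr h
  · have h : (X 1 ^ (q + 1) - (X 0 ^ q + X 0) : MvPolynomial (Fin 3) K) ∈ YIdeal K q t :=
      Ideal.subset_span (by simp)
    simpa using Ideal.Quotient.eq_zero_iff_mem.mpr h

/-- The translation endomorphism of the coordinate ring. -/
theorem Yring_hom (K : Type) [Field K] (p a q t : ℕ) (hp : p.Prime) [CharP K p]
    (hq : q = p ^ a) (d : K) (hd : d ^ q + d = 0) :
    ∃ f : YRing K q t →ₐ[K] YRing K q t,
      f (Ideal.Quotient.mk _ (X 0)) = Ideal.Quotient.mk _ (X 0 + C d) ∧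
      f (Ideal.Quotient.mk _ (X 1)) = Ideal.Quotient.mk _ (X 1) ∧
      f (Ideal.Quotient.mk _ (X 2)) = Ideal.Quotient.mk _ (X 2) := by
  have : Fact p.Prime := ⟨hp⟩
  let g : MvPolynomial (Fin 3) K →ₐ[K] YRing K q t :=
    MvPolynomial.aeval ![Ideal.Quotient.mk _ (X 0 + C d), Ideal.Quotient.mk _ (X 1),
      Ideal.Quotient.mk _ (X 2)]
  have g0 : g (X 0) = Ideal.Quotient.mk _ (X 0 + C d) := by simp [g]
  have g1 : g (X 1) = Ideal.Quotient.mk _ (X 1) := by simp [g]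
  have g2 : g (X 2) = Ideal.Quotient.mk _ (X 2) := by simp [g]
  obtain ⟨r1, r2⟩ := Yring_rel K q t
  have hle : YIdeal K q t ≤ RingHom.ker g.toRingHom := by
    refine Ideal.span_le.mpr ?_
    rintro z (rfl | rfl)
    · change g _ = 0
      rw [map_sub, map_sub, map_pow, map_pow, g1, g2]
      exact r1
    · change g _ = 0
      rw [map_sub, map_add, map_pow, map_pow, g1, g0]
      have h3 : ((X 0 + C d : MvPolynomial (Fin 3) K)) ^ q + (X 0 + C d) = X 0 ^ q + X 0 := by
        have h4 : ((X 0 + C d : MvPolynomial (Fin 3) K)) ^ q = X 0 ^ q + C d ^ q := by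
          rw [hq, add_pow_char_pow]
        have h5 : (C d ^ q + C d : MvPolynomial (Fin 3) K) = 0 := by
          rw [← C_pow, ← C_add, hd, C_0]
        rw [h4]
        linear_combination h5
      have h6 := congrArg (Ideal.Quotient.mk (YIdeal K q t)) h3
      rw [map_add (Ideal.Quotient.mk (YIdeal K q t)) (_ ^ q), map_pow,
        map_add (Ideal.Quotient.mk (YIdeal K q t)) (X 0 ^ q), map_pow] at h6
      rw [h6]
      exact r2
  refine ⟨Ideal.Quotient.liftₐ _ g (fun z hz => hle hz), ?_, ?_, ?_⟩
  · exact (Ideal.Quotient.lift_mk _ _ _).trans g0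
  · exact (Ideal.Quotient.lift_mk _ _ _).trans g1
  · exact (Ideal.Quotient.lift_mk _ _ _).trans g2

theorem Yring_ext (K : Type) [Field K] (q t : ℕ) (f g : YRing K q t →ₐ[K] YRing K q t)
    (h0 : f (Ideal.Quotient.mk _ (X 0)) = g (Ideal.Quotient.mk _ (X 0)))
    (h1 : f (Ideal.Quotient.mk _ (X 1)) = g (Ideal.Quotient.mk _ (X 1)))
    (h2 : f (Ideal.Quotient.mk _ (X 2)) = g (Ideal.Quotient.mk _ (X 2))) : f = g := by
  apply Ideal.Quotient.algHom_ext
  apply MvPolynomial.algHom_ext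
  intro i
  fin_cases i
  · exact h0
  · exact h1
  · exact h2

/-- The translation automorphism of the coordinate ring. -/
theorem Yring_equiv (K : Type) [Field K] (p a q t : ℕ) (hp : p.Prime) [CharP K p]
    (hq : q = p ^ a) (d : K) (hd : d ^ q + d = 0) :
    ∃ f : YRing K q t ≃ₐ[K] YRing K q t,
      f (Ideal.Quotient.mk _ (X 0)) = Ideal.Quotient.mk _ (X 0) + algebraMap K (YRing K q t) d ∧
      f (Ideal.Quotient.mk _ (X 1)) = Ideal.Quotient.mk _ (X 1) ∧
      f (Ideal.Quotient.mk _ (X 2)) = Ideal.Quotient.mk _ (X 2) := by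
  have : Fact p.Prime := ⟨hp⟩
  have hq0 : q ≠ 0 := by rw [hq]; exact pow_ne_zero _ hp.ne_zero
  have hd' : (-d) ^ q + (-d) = 0 := by
    have h0 : (d + -d) ^ q = d ^ q + (-d) ^ q := by rw [hq, add_pow_char_pow]
    rw [add_neg_cancel, zero_pow hq0] at h0
    linear_combination -h0 - hd
  obtain ⟨f, f0, f1, f2⟩ := Yring_hom K p a q t hp hq d hd
  obtain ⟨g, g0, g1, g2⟩ := Yring_hom K p a q t hp hq (-d) hd'
  have hC : ∀ e : K, Ideal.Quotient.mk (YIdeal K q t) (C e) = algebraMap K (YRing K q t) e :=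
    fun e => rfl
  rw [map_add, hC] at f0 g0
  refine ⟨AlgEquiv.ofAlgHom f g ?_ ?_, f0, f1, f2⟩
  · apply Yring_ext
    · rw [AlgHom.comp_apply, g0, map_add, f0, AlgHom.commutes, map_neg]
      simp
    · rw [AlgHom.comp_apply, g1, f1]; rfl
    · rw [AlgHom.comp_apply, g2, f2]; rfl
  · apply Yring_ext
    · rw [AlgHom.comp_apply, f0, map_add, g0, AlgHom.commutes, map_neg]
      simp
    · rw [AlgHom.comp_apply, f1, g1]; rfl
    · rw [AlgHom.comp_apply, f2, g2]; rfl

/-- The translation automorphism of the function field. -/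
theorem Yfield_equiv (K : Type) [Field K] (p a q t : ℕ) (hp : p.Prime) [CharP K p]
    (hq : q = p ^ a) (d : K) (hd : d ^ q + d = 0) [hI : (YIdeal K q t).IsPrime] :
    ∃ σ : YField K q t ≃ₐ[K] YField K q t,
      σ (Yu K q t) = Yu K q t + algebraMap K (YField K q t) d ∧
      σ (Yv K q t) = Yv K q t ∧ σ (Yw K q t) = Yw K q t := by
  obtain ⟨f, f0, f1, f2⟩ := Yring_equiv K p a q t hp hq d hd
  refine ⟨IsFractionRing.algEquivOfAlgEquiv f, ?_, ?_, ?_⟩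
  · rw [Yu, IsFractionRing.algEquivOfAlgEquiv_algebraMap, f0, map_add,
      ← IsScalarTower.algebraMap_apply]
  · rw [Yv, IsFractionRing.algEquivOfAlgEquiv_algebraMap, f1]
  · rw [Yw, IsFractionRing.algEquivOfAlgEquiv_algebraMap, f2]

/-- The function field is generated by `u`, `v`, `w`. -/
theorem Yfield_top (K : Type) [Field K] (q t : ℕ) [hI : (YIdeal K q t).IsPrime] :
    IntermediateField.adjoin K ({Yu K q t, Yv K q t, Yw K q t} : Set (YField K q t)) = ⊤ := by
  rw [eq_top_iff]
  intro z _
  set M := IntermediateField.adjoin K ({Yu K q t, Yv K q t, Yw K q t} : Set (YField K q t))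
    with hM
  have hring : ∀ r : YRing K q t, algebraMap (YRing K q t) (YField K q t) r ∈ M := by
    intro r
    obtain ⟨P, rfl⟩ := Ideal.Quotient.mk_surjective r
    induction P using MvPolynomial.induction_on with
    | C e => exact M.algebraMap_mem e
    | add P Q hP hQ =>
      rw [map_add, map_add]
      exact add_mem hP hQ
    | mul_X P i hP =>
      rw [map_mul, map_mul]
      refine mul_mem hP ?_
      apply IntermediateField.subset_adjoin
      fin_cases i
      · exact Or.inl rfl
      · exact Or.inr (Or.inl rfl)
      · exact Or.inr (Or.inr rfl)
  obtain ⟨x, y, -, rfl⟩ := IsFractionRing.div_surjective (YRing K q t) z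
  exact div_mem (hring x) (hring y)

set_option synthInstance.maxHeartbeats 1000000 in
set_option maxHeartbeats 2000000 in
/-- Theorem: for each `λ ∈ 𝔽_q̄` there is exactly one automorphism
`σ_λ : (u,v,w) ↦ (u + λ/c, v, w)` of `F/K`; the set `E = {σ_λ}` is an elementary abelian
subgroup of `Aut(F/K)` of order `q̄`; and the fixed field `F^E` is `K(x, v, w)`, where
`x = c·u - (c·u)^q̄` (so `X_{a,b,n,s}` is the quotient of `Y_{n,s}` by `E_q̄`). -/
theorem stmt9 (p a b q qb n m s : ℕ) (hp : p.Prime) (ha : 0 < a) (hq : q = p ^ a)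
    (hb : 0 < b) (hba : b ∣ a) (hqb : qb = p ^ b)
    (hn : 3 ≤ n) (hodd : Odd n) (hm : m * (q + 1) = q ^ n + 1)
    (hs : s ∣ m) (hs0 : 0 < s) (hsm : s ≠ m)
    (K : Type) [Field K] [IsAlgClosed K] [CharP K p]
    (c : K) (hc2 : c ^ q ^ 2 = c) (hc : c ^ (q - 1) = -1)
    [hI : (YIdeal K q (m / s)).IsPrime] :
    (∀ l : K, l ^ qb = l →
      ∃! σ : YField K q (m / s) ≃ₐ[K] YField K q (m / s),
        σ (Yu K q (m / s)) = Yu K q (m / s) + algebraMap K (YField K q (m / s)) (l / c) ∧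
        σ (Yv K q (m / s)) = Yv K q (m / s) ∧
        σ (Yw K q (m / s)) = Yw K q (m / s)) ∧
    ∃ E : Subgroup (YField K q (m / s) ≃ₐ[K] YField K q (m / s)),
      (E : Set (YField K q (m / s) ≃ₐ[K] YField K q (m / s)))
          = {σ | ∃ l : K, l ^ qb = l ∧
              σ (Yu K q (m / s)) = Yu K q (m / s) + algebraMap K (YField K q (m / s)) (l / c) ∧
              σ (Yv K q (m / s)) = Yv K q (m / s) ∧
              σ (Yw K q (m / s)) = Yw K q (m / s)} ∧
      (∀ σ τ : E, σ * τ = τ * σ) ∧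
      (∀ σ ∈ E, σ ^ p = 1) ∧
      Nat.card E = qb ∧
      IntermediateField.fixedField E
        = IntermediateField.adjoin K
            ({algebraMap K (YField K q (m / s)) c * Yu K q (m / s)
                - (algebraMap K (YField K q (m / s)) c * Yu K q (m / s)) ^ qb,
              Yv K q (m / s), Yw K q (m / s)} : Set (YField K q (m / s))) := by
  have hq1 : 1 < q := by rw [hq]; exact Nat.one_lt_pow ha.ne' hp.one_lt
  have hc0 : c ≠ 0 := by
    rintro rfl
    rw [zero_pow (by omega)] at hc
    exact one_ne_zero (neg_eq_zero.mp hc.symm)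
  have hcq : c ^ q = -c := by
    have h : c ^ q = c ^ (q - 1) * c := by rw [← pow_succ, Nat.sub_add_cancel hq1.le]
    rw [h, hc, neg_one_mul]
  refine core p b qb hp hb hqb c hc0 _ _ _ (Yfield_top K q (m / s)) ?_
  intro l hl
  have hlq : l ^ q = l := by
    obtain ⟨k, rfl⟩ := hba
    rw [hq, pow_mul, ← hqb]
    clear hq
    induction k with
    | zero => omega
    | succ k ih =>
      rcases Nat.eq_zero_or_pos k with rfl | hk
      · simpa using hl
      · rw [pow_succ, pow_mul, ih (Nat.mul_pos hb hk), hl]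
  refine Yfield_equiv K p a q (m / s) hp hq (l / c) ?_
  rw [div_pow, hlq, hcq, div_neg, neg_add_cancel]
end
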